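/- arXiv:2504.05261 — 3 statements merged into one kernel-verified Lean document; each statement's English description precedes it below -/
import Mathlib

section
/- Let k be an infinite field, R = k[x,y] the standard graded polynomial ring, and 𝔪 = (x,y). Let I and J be nonzero proper homogeneous ideals of R that are both full. Then I + J is full if and only if at least one of the following holds: (1) o(I ∩ J) = max{o(I), o(J)}; or (2) o(I ∩ J) = max{o(I), o(J)} + 1 and (I+J) : 𝔪 ≠ (I : 𝔪) + (J : 𝔪). -/
open MvPolynomial

noncomputable section

variable {k : Type*} [Field k]

/-- An ideal of a polynomial ring is homogeneous if it contains all homogeneous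
components of its elements. -/
def IsHomogeneousIdeal {σ : Type*} (I : Ideal (MvPolynomial σ k)) : Prop :=
  ∀ p ∈ I, ∀ d : ℕ, MvPolynomial.homogeneousComponent d p ∈ I

/-- The homogeneous maximal ideal `(x, y)` of `k[x,y]`. -/
def maxIdeal (k : Type*) [Field k] : Ideal (MvPolynomial (Fin 2) k) :=
  Ideal.span {X 0, X 1}

/-- A homogeneous ideal `I ⊆ k[x,y]` is full if `(I : z) = (I : 𝔪)` for some
linear form `z`. -/
def IsFull (I : Ideal (MvPolynomial (Fin 2) k)) : Prop :=
  ∃ z : MvPolynomial (Fin 2) k, z ≠ 0 ∧ z.IsHomogeneous 1 ∧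
    Submodule.colon I (Ideal.span {z}) = Submodule.colon I (maxIdeal k)

/-- The order `o(I)` of an ideal: the smallest degree of a nonzero homogeneous
element of `I`. -/
def ordDeg (I : Ideal (MvPolynomial (Fin 2) k)) : ℕ :=
  sInf {d : ℕ | ∃ p ∈ I, p ≠ 0 ∧ MvPolynomial.IsHomogeneous p d}


namespace FullSum

/-- Shorthand for the ring. -/
abbrev Rg (k : Type*) [Field k] := MvPolynomial (Fin 2) k

lemma aeval_scale {A : Type*} [CommRing A] [Algebra k A] {n : ℕ} {f : Rg k}
    (hf : f.IsHomogeneous n) (r : A) (v : Fin 2 → A) :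
    aeval (fun i => r * v i) f = r ^ n * aeval v f := by
  rw [aeval_def, aeval_def, eval₂_eq', eval₂_eq', Finset.mul_sum]
  refine Finset.sum_congr rfl fun d hd => ?_
  have h := hf.degree_eq_sum_deg_support hd
  simp only [mul_pow, Finset.prod_mul_distrib, Finset.prod_pow_eq_pow_sum]
  have h2 : ∑ i, d i = n := by
    rw [h]
    symm
    apply Finset.sum_subset (Finset.subset_univ _)
    intro i _ hi
    simpa using hi
  rw [h2]
  ring

/-- The grading map. -/
def gr : Rg k →ₐ[k] Polynomial (Rg k) :=
  aeval (fun i => (Polynomial.X : Polynomial (Rg k)) * Polynomial.C (X i))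

lemma gr_hom {n : ℕ} {f : Rg k} (hf : f.IsHomogeneous n) :
    gr f = Polynomial.X ^ n * Polynomial.C f := by
  rw [gr, aeval_scale hf]
  congr 1
  have : (aeval (fun i => Polynomial.C (X i : Rg k)) : Rg k →ₐ[k] Polynomial (Rg k))
      = IsScalarTower.toAlgHom k (Rg k) (Polynomial (Rg k)) := by
    apply MvPolynomial.algHom_ext
    intro i
    simp [Polynomial.algebraMap_eq]
  rw [this]; rfl

lemma gr_coeff (f : Rg k) (n : ℕ) : (gr f).coeff n = homogeneousComponent n f := by
  conv_lhs => rw [← sum_homogeneousComponent f]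
  rw [map_sum, Polynomial.finsetSum_coeff]
  simp_rw [gr_hom (homogeneousComponent_isHomogeneous _ f), Polynomial.coeff_X_pow_mul']
  by_cases h : n ∈ Finset.range (f.totalDegree + 1)
  · rw [Finset.sum_eq_single_of_mem n h]
    · simp
    · intro b _ hb
      split_ifs with h1
      · rw [Polynomial.coeff_C_of_ne_zero (by omega)]
      · rfl
  · rw [homogeneousComponent_eq_zero _ _ (by simpa using h)]
    refine Finset.sum_eq_zero fun b hb => ?_
    simp only [Finset.mem_range] at h hb
    rw [if_pos (by omega), Polynomial.coeff_C_of_ne_zero (by omega)]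

lemma gr_inj {f : Rg k} (h : gr f = 0) : f = 0 := by
  rw [← sum_homogeneousComponent f]
  refine Finset.sum_eq_zero fun b _ => ?_
  rw [← gr_coeff, h]; simp

lemma hom_of_dvd {n : ℕ} {f g : Rg k} (hf : f.IsHomogeneous n) (hf0 : f ≠ 0) (hg : g ∣ f) :
    ∃ m, g.IsHomogeneous m := by
  obtain ⟨w, rfl⟩ := hg
  have h := gr_hom hf
  rw [map_mul] at h
  have hg0 : gr g ≠ 0 := fun h => left_ne_zero_of_mul hf0 (gr_inj h)
  have hw0 : gr w ≠ 0 := fun h => right_ne_zero_of_mul hf0 (gr_inj h)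
  have h1 := congrArg Polynomial.natDegree h
  have h2 := congrArg Polynomial.natTrailingDegree h
  rw [Polynomial.natDegree_mul hg0 hw0, mul_comm, Polynomial.natDegree_C_mul_X_pow _ _ hf0] at h1
  have e : (Polynomial.X ^ n * Polynomial.C (g * w) : Polynomial (Rg k)).natTrailingDegree = n := by
    rw [mul_comm, Polynomial.C_mul_X_pow_eq_monomial, Polynomial.natTrailingDegree_monomial hf0]
  rw [Polynomial.natTrailingDegree_mul hg0 hw0, e] at h2
  have h3 := Polynomial.natTrailingDegree_le_natDegree (gr g)
  have h4 := Polynomial.natTrailingDegree_le_natDegree (gr w)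
  refine ⟨(gr g).natDegree, ?_⟩
  generalize hN : (gr g).natDegree = N at *
  rw [← sum_homogeneousComponent g]
  refine IsHomogeneous.sum _ _ _ fun i _ => ?_
  by_cases hi : i = N
  · rw [← hi]; exact homogeneousComponent_isHomogeneous _ _
  · rw [← gr_coeff]
    have : (gr g).coeff i = 0 := by
      rcases lt_or_gt_of_ne hi with h | h
      · exact Polynomial.coeff_eq_zero_of_lt_natTrailingDegree (by omega)
      · exact Polynomial.coeff_eq_zero_of_natDegree_lt (by omega)
    rw [this]; exact isHomogeneous_zero _ _ _

/-- Cofactor of a homogeneous product. -/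
lemma hom_cofactor {n m : ℕ} {g w : Rg k} (hf : (g * w).IsHomogeneous n) (hf0 : g * w ≠ 0)
    (hg : g.IsHomogeneous m) : m ≤ n ∧ w.IsHomogeneous (n - m) := by
  obtain ⟨c, hc⟩ := hom_of_dvd hf hf0 (Dvd.intro_left _ rfl)
  have := hf.inj_right (hg.mul hc) hf0
  subst this
  simpa using hc

lemma dvd_deg {n m : ℕ} {g f : Rg k} (hf : f.IsHomogeneous n) (hf0 : f ≠ 0)
    (hg : g.IsHomogeneous m) (h : g ∣ f) : m ≤ n := by
  obtain ⟨w, rfl⟩ := h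
  exact (hom_cofactor hf hf0 hg).1

lemma hc_mul {n m : ℕ} {g : Rg k} (f : Rg k) (hg : g.IsHomogeneous m) :
    homogeneousComponent (n + m) (f * g) = homogeneousComponent n f * g := by
  rw [← gr_coeff, ← gr_coeff, map_mul, gr_hom hg, mul_left_comm, add_comm,
    Polynomial.coeff_X_pow_mul', if_pos (by omega)]
  simp

/-- gcd and lcm data. -/
lemma gcd_data {a b : ℕ} {g h : Rg k} (hg : g.IsHomogeneous a) (hh : h.IsHomogeneous b)
    (hg0 : g ≠ 0) (hh0 : h ≠ 0) :
    ∃ (p l : Rg k) (c e : ℕ), p.IsHomogeneous c ∧ l.IsHomogeneous e ∧ p ≠ 0 ∧ l ≠ 0 ∧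
      c + e = a + b ∧ p ∣ g ∧ p ∣ h ∧ (∀ q, q ∣ g → q ∣ h → q ∣ p) ∧
      g ∣ l ∧ h ∣ l ∧ (∀ q, g ∣ q → h ∣ q → l ∣ q) := by
  classical
  let _ : GCDMonoid (Rg k) := UniqueFactorizationMonoid.toGCDMonoid _
  have hp0 : gcd g h ≠ 0 := by rw [Ne, gcd_eq_zero_iff]; tauto
  have hl0 : lcm g h ≠ 0 := by rw [Ne, lcm_eq_zero_iff]; tauto
  obtain ⟨c, hc⟩ := hom_of_dvd hg hg0 (gcd_dvd_left g h)
  obtain ⟨e, he⟩ := hom_of_dvd (hg.mul hh) (mul_ne_zero hg0 hh0)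
    (lcm_dvd (dvd_mul_right g h) (dvd_mul_left h g))
  refine ⟨gcd g h, lcm g h, c, e, hc, he, hp0, hl0, ?_, gcd_dvd_left _ _, gcd_dvd_right _ _,
    fun q => dvd_gcd, dvd_lcm_left _ _, dvd_lcm_right _ _, fun q => lcm_dvd⟩
  have h := gcd_mul_lcm g h
  exact le_antisymm (dvd_deg (hg.mul hh) (mul_ne_zero hg0 hh0) (hc.mul he) h.dvd)
    (dvd_deg (hc.mul he) (mul_ne_zero hp0 hl0) (hg.mul hh) h.symm.dvd)

lemma X0_not_dvd : ¬ (X 0 : Rg k) ∣ X 1 := by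
  rw [X_dvd_X]
  simp

lemma relPrimeX (n : ℕ) : IsRelPrime ((X 0 : Rg k) ^ n) ((X 1 : Rg k) ^ n) := by
  apply IsRelPrime.pow
  exact (X_prime (R := k) (i := (0 : Fin 2))).irreducible.isRelPrime_iff_not_dvd.2 X0_not_dvd

lemma dvd_of_dvd_pow {g f : Rg k} (n : ℕ) (h0 : g ∣ f * X 0 ^ n) (h1 : g ∣ f * X 1 ^ n) :
    g ∣ f := by
  classical
  let _ : GCDMonoid (Rg k) := UniqueFactorizationMonoid.toGCDMonoid _
  have h := dvd_gcd h0 h1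
  have h2 := h.trans (gcd_mul_left' f _ _).dvd
  have hu : IsUnit (gcd ((X 0 : Rg k) ^ n) (X 1 ^ n)) :=
    relPrimeX n (gcd_dvd_left _ _) (gcd_dvd_right _ _)
  exact hu.dvd_mul_right.1 h2

lemma dvd_of_dvd_X {g f : Rg k} (h0 : g ∣ f * X 0) (h1 : g ∣ f * X 1) : g ∣ f :=
  dvd_of_dvd_pow 1 (by simpa using h0) (by simpa using h1)

/-- multiples of `g` in degree `d` -/
def M (g : Rg k) (d : ℕ) : Submodule k (Rg k) :=
  homogeneousSubmodule (Fin 2) k d ⊓ (Ideal.span {g}).restrictScalars k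

lemma mem_M {g f : Rg k} {d : ℕ} : f ∈ M g d ↔ f.IsHomogeneous d ∧ g ∣ f := by
  simp [M, Ideal.mem_span_singleton]

lemma finrank_hom (d : ℕ) : Module.finrank k (homogeneousSubmodule (Fin 2) k d) = d + 1 := by
  let e : Fin (d + 1) → (Fin 2 →₀ ℕ) := fun i =>
    Finsupp.single 0 (i : ℕ) + Finsupp.single 1 (d - i)
  have he : Function.Injective e := by
    intro i j hij
    have := DFunLike.congr_fun hij 0
    ext
    simpa [e] using this
  have hli : LinearIndependent k (fun i => basisMonomials (Fin 2) k (e i)) :=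
    (basisMonomials (Fin 2) k).linearIndependent.comp e he
  have hs : homogeneousSubmodule (Fin 2) k d
      = Submodule.span k (Set.range (fun i => basisMonomials (Fin 2) k (e i))) := by
    apply le_antisymm
    · intro f hf
      rw [mem_homogeneousSubmodule] at hf
      rw [f.as_sum]
      refine Submodule.sum_mem _ fun s hs => ?_
      have hd : s 0 + s 1 = d := by
        by_contra hne
        have : s.degree ≠ d := by
          rw [Finsupp.degree_eq_sum]; simpa using hne
        exact (mem_support_iff.1 hs) (hf.coeff_eq_zero this)
      have hes : e ⟨s 0, by omega⟩ = s := by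
        ext i
        fin_cases i <;> simp [e]
        omega
      have : monomial s (coeff s f) = coeff s f • basisMonomials (Fin 2) k (e ⟨s 0, by omega⟩) := by
        rw [hes]; simp [smul_monomial]
      rw [this]
      exact Submodule.smul_mem _ _ (Submodule.subset_span ⟨_, rfl⟩)
    · rw [Submodule.span_le]
      rintro _ ⟨i, rfl⟩
      simp only [coe_basisMonomials, SetLike.mem_coe, mem_homogeneousSubmodule]
      apply isHomogeneous_monomial
      rw [Finsupp.degree_eq_sum]
      simp [e]
      omega
  rw [hs, finrank_span_eq_card hli]
  simp

instance (d : ℕ) : FiniteDimensional k (homogeneousSubmodule (Fin 2) k d) :=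
  Module.Finite.iff_fg.2 (homogeneousSubmodule_fg _ _ d)

instance (g : Rg k) (d : ℕ) : FiniteDimensional k (M g d) :=
  Submodule.finiteDimensional_of_le (inf_le_left (b := (Ideal.span {g}).restrictScalars k))

lemma finrank_M {a : ℕ} {g : Rg k} (hg : g.IsHomogeneous a) (hg0 : g ≠ 0) (d : ℕ) :
    Module.finrank k (M g d) = d + 1 - a := by
  by_cases h : a ≤ d
  · have : M g d = (homogeneousSubmodule (Fin 2) k (d - a)).map (LinearMap.mulLeft k g) := by
      ext f
      rw [mem_M, Submodule.mem_map]
      constructor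
      · rintro ⟨hf, w, rfl⟩
        by_cases h0 : g * w = 0
        · exact ⟨0, by simp, by simp [h0]⟩
        · exact ⟨w, (hom_cofactor hf h0 hg).2, rfl⟩
      · rintro ⟨w, hw, rfl⟩
        refine ⟨?_, Dvd.intro _ rfl⟩
        have := hg.mul ((mem_homogeneousSubmodule _ _).1 hw)
        rwa [Nat.add_sub_cancel' h] at this
    rw [this, ← (Submodule.equivMapOfInjective (LinearMap.mulLeft k g)
      (mul_right_injective₀ hg0) _).finrank_eq, finrank_hom]
    omega
  · have : M g d = ⊥ := by
      rw [eq_bot_iff]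
      intro f hf
      rw [mem_M] at hf
      by_contra h0
      exact h (dvd_deg hf.1 h0 hg hf.2)
    rw [this, finrank_bot]; omega

/-- gcd and lcm data, as a structure -/
structure GLD (g h : Rg k) (a b : ℕ) (p l : Rg k) (c e : ℕ) : Prop where
  hg : g.IsHomogeneous a
  hh : h.IsHomogeneous b
  hg0 : g ≠ 0
  hh0 : h ≠ 0
  hp : p.IsHomogeneous c
  hl : l.IsHomogeneous e
  hp0 : p ≠ 0
  hl0 : l ≠ 0
  deg : c + e = a + b
  pg : p ∣ g
  ph : p ∣ h
  gcd : ∀ q, q ∣ g → q ∣ h → q ∣ p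
  gl : g ∣ l
  hl' : h ∣ l
  lcm : ∀ q, g ∣ q → h ∣ q → l ∣ q

lemma exists_GL {a b : ℕ} {g h : Rg k} (hg : g.IsHomogeneous a) (hh : h.IsHomogeneous b)
    (hg0 : g ≠ 0) (hh0 : h ≠ 0) : ∃ (p l : Rg k) (c e : ℕ), GLD g h a b p l c e := by
  obtain ⟨p, l, c, e, h1, h2, h3, h4, h5, h6, h7, h8, h9, h10, h11⟩ := gcd_data hg hh hg0 hh0
  exact ⟨p, l, c, e, hg, hh, hg0, hh0, h1, h2, h3, h4, h5, h6, h7, h8, h9, h10, h11⟩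

section
variable {g h p l : Rg k} {a b c e : ℕ}

lemma GLD.rank (D : GLD g h a b p l c e) (d : ℕ) :
    Module.finrank k (M g d ⊔ M h d : Submodule k (Rg k)) + (d + 1 - e)
      = (d + 1 - a) + (d + 1 - b) := by
  have : M g d ⊓ M h d = M l d := by
    ext f
    simp only [Submodule.mem_inf, mem_M]
    constructor
    · rintro ⟨⟨h1, h2⟩, _, h3⟩
      exact ⟨h1, D.lcm _ h2 h3⟩
    · rintro ⟨h1, h2⟩
      exact ⟨⟨h1, D.gl.trans h2⟩, h1, D.hl'.trans h2⟩
  have h1 := Submodule.finrank_sup_add_finrank_inf_eq (M g d) (M h d)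
  rwa [this, finrank_M D.hl D.hl0, finrank_M D.hg D.hg0, finrank_M D.hh D.hh0] at h1

lemma GLD.sup_le (D : GLD g h a b p l c e) (d : ℕ) : M g d ⊔ M h d ≤ M p d := by
  apply _root_.sup_le <;> intro f hf <;> rw [mem_M] at hf ⊢
  · exact ⟨hf.1, D.pg.trans hf.2⟩
  · exact ⟨hf.1, D.ph.trans hf.2⟩

lemma GLD.le1 (D : GLD g h a b p l c e) : a ≤ e := dvd_deg D.hl D.hl0 D.hg D.gl
lemma GLD.le2 (D : GLD g h a b p l c e) : b ≤ e := dvd_deg D.hl D.hl0 D.hh D.hl'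
lemma GLD.le3 (D : GLD g h a b p l c e) : c ≤ a := dvd_deg D.hg D.hg0 D.hp D.pg
lemma GLD.le4 (D : GLD g h a b p l c e) : c ≤ b := dvd_deg D.hh D.hh0 D.hp D.ph

lemma GLD.sup_eq (D : GLD g h a b p l c e) {d : ℕ} (hd : e ≤ d + 1) : M g d ⊔ M h d = M p d := by
  apply Submodule.eq_of_le_of_finrank_eq (D.sup_le d)
  rw [finrank_M D.hp D.hp0]
  have := D.rank d
  have := D.le1
  have := D.le2
  have := D.deg
  omega

lemma GLD.le_of_sup_eq (D : GLD g h a b p l c e) {d : ℕ} (hd : M g d ⊔ M h d = M p d)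
    (ha : a ≤ d + 1) (hb : b ≤ d + 1) : e ≤ d + 1 := by
  have h1 := D.rank d
  rw [hd, finrank_M D.hp D.hp0] at h1
  have := D.le3
  have := D.le4
  have := D.deg
  omega

end

/-- the linear form vanishing at `P` -/
def zP (P : Fin 2 → k) : Rg k := C (P 1) * X 0 - C (P 0) * X 1

lemma zP_hom (P : Fin 2 → k) : (zP P).IsHomogeneous 1 :=
  (isHomogeneous_C_mul_X _ _).sub (isHomogeneous_C_mul_X _ _)

lemma eval_zP (P : Fin 2 → k) : eval P (zP P) = 0 := by
  simp [zP]; ring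

lemma exists_zP {z : Rg k} (hz : z.IsHomogeneous 1) : ∃ P : Fin 2 → k, z = zP P := by
  rw [← mem_homogeneousSubmodule, homogeneousSubmodule_one_eq_span_X,
    Submodule.mem_span_range_iff_exists_fun] at hz
  obtain ⟨c, hc⟩ := hz
  refine ⟨![-c 1, c 0], ?_⟩
  rw [← hc, zP]
  simp [Fin.sum_univ_two, smul_eq_C_mul]

lemma zP_ne {P : Fin 2 → k} (j : Fin 2) (hj : P j ≠ 0) : zP P ≠ 0 := by
  intro h
  have h0 := congrArg (eval ![1, 0]) h
  have h1 := congrArg (eval ![0, 1]) h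
  simp [zP] at h0 h1
  fin_cases j
  · exact hj h1
  · exact hj h0

lemma dvd_of_eval {P : Fin 2 → k} (j : Fin 2) (hj : P j ≠ 0) {n : ℕ} {f : Rg k}
    (hf : f.IsHomogeneous n) (h : eval P f = 0) : zP P ∣ f := by
  have h1 : aeval (fun i => C (P j) * X i) f = C (P j) ^ n * f := by
    rw [aeval_scale hf]; simp
  have h2 : aeval (fun i => (X j : Rg k) * C (P i)) f = 0 := by
    rw [aeval_scale hf]
    have : aeval (fun i => (C (P i) : Rg k)) f = C (eval P f) := by
      rw [aeval_def, eval, coe_eval₂Hom, eval₂_comp_left (C : k →+* Rg k)]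
      rfl
    rw [this, h]; simp
  have h3 : zP P ∣ C (P j) ^ n * f := by
    rw [← h1, ← sub_zero (aeval _ f), ← h2, ← Ideal.mem_span_singleton, ← Ideal.Quotient.mk_eq_mk_iff_sub_mem]
    set q := Ideal.Quotient.mkₐ k (Ideal.span {zP P}) with hq
    change q _ = q _
    rw [← AlgHom.comp_apply, ← AlgHom.comp_apply, comp_aeval, comp_aeval]
    congr 2
    funext i
    have hz : q (C (P 1) * X 0 - C (P 0) * X 1) = 0 := Ideal.Quotient.eq_zero_iff_mem.2 (Ideal.mem_span_singleton_self _)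
    rw [map_sub, sub_eq_zero] at hz
    fin_cases i <;> fin_cases j <;> simp
    · ring
    · simpa [mul_comm] using hz
    · simpa [mul_comm] using hz.symm
    · ring
  have hu : IsUnit ((C (P j) : Rg k) ^ n) := (hj.isUnit.map C).pow n
  exact hu.dvd_mul_left.1 h3

lemma dec {P : Fin 2 → k} (j : Fin 2) (hj : P j ≠ 0) {m s : ℕ} {g f : Rg k}
    (hg : g.IsHomogeneous m) (hgP : eval P g ≠ 0) (hf : f.IsHomogeneous (m + s)) :
    ∃ (c : k) (f1 : Rg k), f1.IsHomogeneous (m + s - 1) ∧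
      f = C c * X j ^ s * g + zP P * f1 ∧ (f1 = 0 ∨ 1 ≤ m + s) := by
  set c := eval P f / (P j ^ s * eval P g)
  have hh : (f - C c * X j ^ s * g).IsHomogeneous (m + s) := by
    apply hf.sub
    have := (isHomogeneous_C_mul_X_pow (R := k) c j s).mul hg
    rwa [add_comm] at this
  have he : eval P (f - C c * X j ^ s * g) = 0 := by
    simp [c]
    field_simp
    simp
  obtain ⟨f1, h1⟩ := dvd_of_eval j hj hh he
  by_cases h0 : f1 = 0
  · refine ⟨c, 0, isHomogeneous_zero _ _ _, ?_, Or.inl rfl⟩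
    rw [h0] at h1
    linear_combination h1
  · rw [h1] at hh
    obtain ⟨h2, h3⟩ := hom_cofactor hh (mul_ne_zero (zP_ne j hj) h0) (zP_hom P)
    exact ⟨c, f1, h3, by linear_combination h1, Or.inr h2⟩

lemma mem_colon_max {I : Ideal (Rg k)} {f : Rg k} :
    f ∈ Submodule.colon I (maxIdeal k) ↔ f * X 0 ∈ I ∧ f * X 1 ∈ I := by
  rw [maxIdeal, Ideal.colon_span, Submodule.mem_colon]
  simp

/-- the degree `d` part of `I` consists of the multiples of `g`. -/
structure Dat (I : Ideal (Rg k)) (d : ℕ) (g : Rg k) (a : ℕ) : Prop where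
  ne : g ≠ 0
  hom : g.IsHomogeneous a
  le : a ≤ d
  iff : ∀ f : Rg k, f.IsHomogeneous d → (f ∈ I ↔ g ∣ f)

/-- All nonzero graded parts are multiples of one form. -/
def Good (I : Ideal (Rg k)) : Prop :=
  ∀ (d : ℕ) (f : Rg k), f ∈ I → f ≠ 0 → f.IsHomogeneous d → ∃ g a, Dat I d g a

lemma Dat.mono {I : Ideal (Rg k)} {d d' a a' : ℕ} {g g' : Rg k} (D : Dat I d g a)
    (D' : Dat I d' g' a') (h : d ≤ d') : g' ∣ g := by
  have key : ∀ i : Fin 2, g' ∣ g * X i ^ (d' - a) := by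
    intro i
    have hle := D.le
    have h1 : (g * X i ^ (d - a)).IsHomogeneous d := by
      have := D.hom.mul (isHomogeneous_X_pow (R := k) i (d - a))
      rwa [Nat.add_sub_cancel' hle] at this
    have h2 : (g * X i ^ (d' - a)).IsHomogeneous d' := by
      have := D.hom.mul (isHomogeneous_X_pow (R := k) i (d' - a))
      rwa [Nat.add_sub_cancel' (hle.trans h)] at this
    rw [← D'.iff _ h2]
    have h3 := (D.iff _ h1).2 (dvd_mul_right _ _)
    have : g * X i ^ (d' - a) = g * X i ^ (d - a) * X i ^ (d' - d) := by
      rw [mul_assoc, ← pow_add]; congr 2; omega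
    rw [this]
    exact I.mul_mem_right _ h3
  exact dvd_of_dvd_pow _ (key 0) (key 1)

lemma full_good {I : Ideal (Rg k)} (hI : IsFull I) : Good I := by
  obtain ⟨z, hz0, hz1, hz⟩ := hI
  obtain ⟨P, rfl⟩ := exists_zP hz1
  obtain ⟨j, hj⟩ : ∃ j, P j ≠ 0 := by
    by_contra! h
    apply hz0
    simp [zP, h]
  have hz' : ∀ f, f * zP P ∈ I → f * X j ∈ I := by
    intro f hf
    rw [← Ideal.mem_colon_span_singleton, hz, mem_colon_max] at hf
    fin_cases j
    · exact hf.1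
    · exact hf.2
  have step : ∀ (i : ℕ) (f w : Rg k), f * zP P ^ i ∈ I → w.IsHomogeneous i → f * w ∈ I := by
    intro i
    induction i with
    | zero =>
      intro f w hf _
      exact I.mul_mem_right _ (by simpa using hf)
    | succ i ih =>
      intro f w hf hw
      obtain ⟨c, w1, hw1, hw2, -⟩ := dec (m := 0) (s := i + 1) j hj (isHomogeneous_one (Fin 2) k)
        (by simp) (by simpa using hw)
      have hf' : (f * zP P) * zP P ^ i ∈ I := by
        convert! hf using 1; ring
      have e1 := ih _ w1 hf' (by simpa using hw1)
      have e2 := ih _ (X j ^ i) hf' (isHomogeneous_X_pow _ _)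
      have e3 := hz' (f * X j ^ i) (by convert! e2 using 1; ring)
      rw [hw2]
      have : f * (C c * X j ^ (i + 1) * 1 + zP P * w1) = C c * (f * X j ^ i * X j) + f * zP P * w1 := by
        ring
      rw [this]
      exact I.add_mem (I.mul_mem_left _ e3) e1
  intro d f0 hf0 hf00 hf0d
  classical
  let Q : ℕ → Prop := fun i => i ≤ d ∧ ∃ g, g ≠ 0 ∧ g.IsHomogeneous (d - i) ∧ g * zP P ^ i ∈ I
  have hQ0 : Q 0 := ⟨Nat.zero_le _, f0, hf00, by simpa using hf0d, by simpa using hf0⟩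
  set i := Nat.findGreatest Q d with hi
  have hQi : Q i := Nat.findGreatest_spec (Nat.zero_le d) hQ0
  have hmax : ∀ i', i < i' → ¬ Q i' := fun i' h h' => Nat.findGreatest_is_greatest h h'.1 h'
  clear_value i
  obtain ⟨hid, g, hg0, hgh, hgI⟩ := hQi
  have hgP : eval P g ≠ 0 := by
    intro h
    obtain ⟨g', rfl⟩ := dvd_of_eval j hj hgh h
    obtain ⟨h1, h2⟩ := hom_cofactor hgh hg0 (zP_hom P)
    refine hmax (i + 1) (by omega) ⟨by omega, g', right_ne_zero_of_mul hg0, ?_, ?_⟩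
    · convert! h2 using 1
    · convert! hgI using 1; ring
  have claim : ∀ (s j' : ℕ) (f : Rg k), j' + s = i → f.IsHomogeneous (d - j') →
      f * zP P ^ j' ∈ I → g ∣ f := by
    intro s
    induction s with
    | zero =>
      intro j' f hs hf hfI
      obtain rfl : j' = i := by omega
      obtain ⟨c, f1, hf1, hf2, h3⟩ := dec (s := 0) j hj hgh hgP (by simpa using hf)
      by_cases h0 : f1 = 0
      · rw [hf2, h0]; simp
      · exfalso
        have h4 := h3.resolve_left h0
        refine hmax (j' + 1) (by omega) ⟨by omega, f1, h0, by convert! hf1 using 1, ?_⟩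
        have : f1 * zP P ^ (j' + 1) = f * zP P ^ j' - C c * (g * zP P ^ j') := by
          rw [hf2]; ring
        rw [this]
        exact I.sub_mem hfI (I.mul_mem_left _ hgI)
    | succ s ih =>
      intro j' f hs hf hfI
      obtain ⟨c, f1, hf1, hf2, h3⟩ := dec (s := s + 1) j hj hgh hgP
        (by convert! hf using 1; omega)
      have h5 : g ∣ f1 := by
        apply ih (j' + 1) f1 (by omega)
        · convert! hf1 using 1; omega
        · have : f1 * zP P ^ (j' + 1) = f * zP P ^ j' - C c * (g * (X j ^ (s + 1) * zP P ^ j')) := by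
            rw [hf2]; ring
          rw [this]
          refine I.sub_mem hfI (I.mul_mem_left _ (step i _ _ hgI ?_))
          have := (isHomogeneous_X_pow (R := k) j (s + 1)).mul ((zP_hom P).pow j')
          convert! this using 1; omega
      rw [hf2]
      exact dvd_add (dvd_mul_left _ _) (h5.mul_left _)
  refine ⟨g, d - i, hg0, hgh, by omega, fun f hf => ⟨fun hfI => ?_, ?_⟩⟩
  · exact claim i 0 f (by omega) (by simpa using hf) (by simpa using hfI)
  · rintro ⟨w, rfl⟩
    by_cases h0 : g * w = 0
    · rw [h0]; exact I.zero_mem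
    · obtain ⟨_, h2⟩ := hom_cofactor hf h0 hgh
      exact step i _ _ hgI (by convert! h2 using 1; omega)

lemma exists_hom {I : Ideal (Rg k)} (hI : IsHomogeneousIdeal I) (h0 : I ≠ ⊥) :
    ∃ f ∈ I, f ≠ 0 ∧ f.IsHomogeneous (ordDeg I) := by
  have : {d : ℕ | ∃ p ∈ I, p ≠ 0 ∧ MvPolynomial.IsHomogeneous p d}.Nonempty := by
    obtain ⟨f, hf, hf0⟩ := Submodule.exists_mem_ne_zero_of_ne_bot h0
    by_contra hne
    rw [Set.not_nonempty_iff_eq_empty, Set.eq_empty_iff_forall_notMem] at hne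
    apply hf0
    rw [← sum_homogeneousComponent f]
    refine Finset.sum_eq_zero fun i _ => ?_
    by_contra h
    exact hne i ⟨_, hI f hf i, h, homogeneousComponent_isHomogeneous _ _⟩
  exact Nat.sInf_mem this

lemma ord_le {I : Ideal (Rg k)} {d : ℕ} {f : Rg k} (hf : f ∈ I) (hf0 : f ≠ 0)
    (hfd : f.IsHomogeneous d) : ordDeg I ≤ d :=
  Nat.sInf_le ⟨f, hf, hf0, hfd⟩

lemma Good.dat {I : Ideal (Rg k)} (hg : Good I) (hI : IsHomogeneousIdeal I) (h0 : I ≠ ⊥) {d : ℕ}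
    (hd : ordDeg I ≤ d) : ∃ g a, Dat I d g a := by
  obtain ⟨f, hf, hf0, hfd⟩ := exists_hom hI h0
  refine hg d (f * X 0 ^ (d - ordDeg I)) (I.mul_mem_right _ hf)
    (mul_ne_zero hf0 (pow_ne_zero _ (X_ne_zero _))) ?_
  have := hfd.mul (isHomogeneous_X_pow (R := k) 0 (d - ordDeg I))
  rwa [Nat.add_sub_cancel' hd] at this

lemma mem_of_comp {I : Ideal (Rg k)} {f : Rg k} (h : ∀ d, homogeneousComponent d f ∈ I) :
    f ∈ I := by
  rw [← sum_homogeneousComponent f]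
  exact I.sum_mem fun i _ => h i

lemma hom_mulX {d : ℕ} {f : Rg k} (hf : f.IsHomogeneous d) (i : Fin 2) :
    (f * X i).IsHomogeneous (d + 1) := hf.mul (isHomogeneous_X _ _)

lemma colon_hom {I : Ideal (Rg k)} (hI : IsHomogeneousIdeal I) :
    IsHomogeneousIdeal (Submodule.colon I (maxIdeal k)) := by
  intro f hf d
  rw [mem_colon_max] at hf ⊢
  rw [← hc_mul f (isHomogeneous_X _ _), ← hc_mul f (isHomogeneous_X _ _)]
  exact ⟨hI _ hf.1 _, hI _ hf.2 _⟩

lemma good_full [Infinite k] {I : Ideal (Rg k)} (hI : IsHomogeneousIdeal I) (h0 : I ≠ ⊥)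
    (hg : Good I) : IsFull I := by
  obtain ⟨g, a, D⟩ := hg.dat hI h0 le_rfl
  obtain ⟨P, hP⟩ : ∃ P, eval P (g * X 1) ≠ 0 := by
    by_contra! h
    exact mul_ne_zero D.ne (X_ne_zero _) (MvPolynomial.funext (q := 0) (by simpa using h))
  rw [map_mul, eval_X] at hP
  have hgP := left_ne_zero_of_mul hP
  have hj := right_ne_zero_of_mul hP
  refine ⟨zP P, zP_ne 1 hj, zP_hom P, le_antisymm ?_ ?_⟩
  · intro f hf
    rw [Ideal.mem_colon_span_singleton] at hf
    apply mem_of_comp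
    intro d
    have h1 := hI _ hf (d + 1)
    rw [hc_mul f (zP_hom P)] at h1
    have hf' := homogeneousComponent_isHomogeneous d f
    generalize homogeneousComponent d f = f' at *
    rw [mem_colon_max]
    by_cases hf0 : f' = 0
    · simp [hf0]
    have hne := mul_ne_zero hf0 (zP_ne 1 hj)
    have hh := hf'.mul (zP_hom P)
    obtain ⟨g', a', D'⟩ := hg (d + 1) _ h1 hne hh
    obtain ⟨v, hv⟩ := D.mono D' (ord_le h1 hne hh)
    rw [D'.iff _ hh] at h1
    obtain ⟨w, hw⟩ := h1
    rw [hw] at hh hne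
    have hw1 := (hom_cofactor hh hne D'.hom).2
    have hew : eval P w = 0 := by
      have := congrArg (eval P) hw
      rw [map_mul, map_mul, eval_zP, mul_zero] at this
      refine (mul_eq_zero.1 this.symm).resolve_left fun h => hgP ?_
      rw [hv, map_mul, h, zero_mul]
    obtain ⟨w', rfl⟩ := dvd_of_eval 1 hj hw1 hew
    have : f' = g' * w' := by
      apply mul_right_cancel₀ (zP_ne 1 hj)
      rw [hw]; ring
    have hd : g' ∣ f' := ⟨w', this⟩
    exact ⟨(D'.iff _ (hom_mulX hf' 0)).2 (hd.mul_right _),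
      (D'.iff _ (hom_mulX hf' 1)).2 (hd.mul_right _)⟩
  · intro f hf
    rw [mem_colon_max] at hf
    rw [Ideal.mem_colon_span_singleton, zP]
    have : f * (C (P 1) * X 0 - C (P 0) * X 1) = C (P 1) * (f * X 0) - C (P 0) * (f * X 1) := by
      ring
    rw [this]
    exact I.sub_mem (I.mul_mem_left _ hf.1) (I.mul_mem_left _ hf.2)

section
variable {I J : Ideal (Rg k)}

lemma sum_decomp (hI : IsHomogeneousIdeal I) (hJ : IsHomogeneousIdeal J) {f : Rg k} (d : ℕ)
    (hf : f ∈ I + J) : ∃ u ∈ I, ∃ v ∈ J, u.IsHomogeneous d ∧ v.IsHomogeneous d ∧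
      homogeneousComponent d f = u + v := by
  rw [Submodule.add_eq_sup, Submodule.mem_sup] at hf
  obtain ⟨u, hu, v, hv, rfl⟩ := hf
  exact ⟨_, hI u hu d, _, hJ v hv d, homogeneousComponent_isHomogeneous _ _,
    homogeneousComponent_isHomogeneous _ _, map_add _ _ _⟩

lemma sum_decomp' (hI : IsHomogeneousIdeal I) (hJ : IsHomogeneousIdeal J) {f : Rg k} {d : ℕ}
    (hf : f ∈ I + J) (hd : f.IsHomogeneous d) :
    ∃ u ∈ I, ∃ v ∈ J, u.IsHomogeneous d ∧ v.IsHomogeneous d ∧ f = u + v := by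
  have := sum_decomp hI hJ d hf
  rwa [homogeneousComponent_eq_self hd] at this

lemma mem_add {u v : Rg k} (hu : u ∈ I) (hv : v ∈ J) : u + v ∈ I + J := by
  rw [Submodule.add_eq_sup]
  exact Submodule.add_mem_sup hu hv

lemma add_hom (hI : IsHomogeneousIdeal I) (hJ : IsHomogeneousIdeal J) :
    IsHomogeneousIdeal (I + J) := by
  intro f hf d
  obtain ⟨u, hu, v, hv, -, -, h⟩ := sum_decomp hI hJ d hf
  rw [h]
  exact mem_add hu hv

lemma sum_iff (hI : IsHomogeneousIdeal I) (hJ : IsHomogeneousIdeal J) {d a b : ℕ} {g h : Rg k}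
    (D : Dat I d g a) (E : Dat J d h b) {f : Rg k} (hf : f.IsHomogeneous d) :
    f ∈ I + J ↔ f ∈ M g d ⊔ M h d := by
  constructor
  · intro h1
    obtain ⟨u, hu, v, hv, hud, hvd, rfl⟩ := sum_decomp' hI hJ h1 hf
    exact Submodule.add_mem_sup (mem_M.2 ⟨hud, (D.iff _ hud).1 hu⟩)
      (mem_M.2 ⟨hvd, (E.iff _ hvd).1 hv⟩)
  · intro h1
    obtain ⟨u, hu, v, hv, rfl⟩ := Submodule.mem_sup.1 h1
    rw [mem_M] at hu hv
    exact mem_add ((D.iff _ hu.1).2 hu.2) ((E.iff _ hv.1).2 hv.2)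

lemma hom_X_pow {d a : ℕ} {g : Rg k} (hg : g.IsHomogeneous a) (h : a ≤ d) (i : Fin 2) :
    (g * X i ^ (d - a)).IsHomogeneous d := by
  have := hg.mul (isHomogeneous_X_pow (R := k) i (d - a))
  rwa [Nat.add_sub_cancel' h] at this

lemma full_iff [Infinite k] (hI : IsHomogeneousIdeal I) (hJ : IsHomogeneousIdeal J)
    (hI0 : I ≠ ⊥) (hJ0 : J ≠ ⊥) (gI : Good I) (gJ : Good J) (hle : ordDeg I ≤ ordDeg J)
    {g h p l : Rg k} {a b c e : ℕ} (D : Dat I (ordDeg J) g a) (E : Dat J (ordDeg J) h b)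
    (G : GLD g h a b p l c e) : IsFull (I + J) ↔ e ≤ ordDeg J + 1 := by
  have hK := add_hom hI hJ
  have hIK : I ≤ I + J := by rw [Submodule.add_eq_sup]; exact le_sup_left
  have hJK : J ≤ I + J := by rw [Submodule.add_eq_sup]; exact le_sup_right
  have hK0 : I + J ≠ ⊥ := fun h => hI0 (eq_bot_iff.2 (h ▸ hIK))
  constructor
  · intro hF
    obtain ⟨f, hf, hf0, hfd⟩ := exists_hom hJ hJ0
    obtain ⟨q, s, Q⟩ := full_good hF _ f (hJK hf) hf0 hfd
    have hqg : q ∣ g := by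
      have : ∀ i, q ∣ g * X i ^ (ordDeg J - a) := fun i => by
        have hh := hom_X_pow D.hom D.le i
        exact (Q.iff _ hh).1 (hIK ((D.iff _ hh).2 (dvd_mul_right _ _)))
      exact dvd_of_dvd_pow _ (this 0) (this 1)
    have hqh : q ∣ h := by
      have : ∀ i, q ∣ h * X i ^ (ordDeg J - b) := fun i => by
        have hh := hom_X_pow E.hom E.le i
        exact (Q.iff _ hh).1 (hJK ((E.iff _ hh).2 (dvd_mul_right _ _)))
      exact dvd_of_dvd_pow _ (this 0) (this 1)
    have hqp := G.gcd q hqg hqh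
    apply G.le_of_sup_eq _ (D.le.trans (Nat.le_succ _)) (E.le.trans (Nat.le_succ _))
    apply le_antisymm (G.sup_le _)
    intro f hf
    rw [mem_M] at hf
    rw [← sum_iff hI hJ D E hf.1]
    exact (Q.iff _ hf.1).2 (hqp.trans hf.2)
  · intro he
    apply good_full hK hK0
    intro d f hf hf0 hfd
    by_cases hd : d < ordDeg J
    · have hKI : ∀ f : Rg k, f.IsHomogeneous d → (f ∈ I + J ↔ f ∈ I) := by
        intro f hfd
        refine ⟨fun hf => ?_, fun hf => hIK hf⟩
        obtain ⟨u, hu, v, hv, hud, hvd, rfl⟩ := sum_decomp' hI hJ hf hfd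
        have : v = 0 := by
          by_contra h0
          exact absurd (ord_le hv h0 hvd) (by omega)
        rwa [this, add_zero]
      obtain ⟨q, s, Q⟩ := gI d f ((hKI f hfd).1 hf) hf0 hfd
      exact ⟨q, s, Q.ne, Q.hom, Q.le, fun f hf => (hKI f hf).trans (Q.iff f hf)⟩
    · push Not at hd
      obtain ⟨g', a', D'⟩ := gI.dat hI hI0 (hle.trans hd)
      obtain ⟨h', b', E'⟩ := gJ.dat hJ hJ0 hd
      obtain ⟨p', l', c', e', G'⟩ := exists_GL D'.hom E'.hom D'.ne E'.ne
      have hl : l' ∣ l := G'.lcm _ ((D.mono D' hd).trans G.gl) ((E.mono E' hd).trans G.hl')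
      have he' : e' ≤ e := dvd_deg G.hl G.hl0 G'.hl hl
      refine ⟨p', c', G'.hp0, G'.hp, G'.le3.trans D'.le, fun f hf => ?_⟩
      rw [sum_iff hI hJ D' E' hf, G'.sup_eq (by omega), mem_M]
      exact and_iff_right hf

lemma main_aux [Infinite k] (hI : IsHomogeneousIdeal I) (hJ : IsHomogeneousIdeal J)
    (hI0 : I ≠ ⊥) (hJ0 : J ≠ ⊥) (hJtop : J ≠ ⊤) (gI : Good I) (gJ : Good J)
    (hle : ordDeg I ≤ ordDeg J) :
    IsFull (I + J) ↔
      ordDeg (I ⊓ J) = ordDeg J ∨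
      (ordDeg (I ⊓ J) = ordDeg J + 1 ∧
        Submodule.colon (I + J) (maxIdeal k) ≠
          Submodule.colon I (maxIdeal k) + Submodule.colon J (maxIdeal k)) := by
  obtain ⟨g, a, D⟩ := gI.dat hI hI0 hle
  obtain ⟨h, b, E⟩ := gJ.dat hJ hJ0 le_rfl
  obtain ⟨g1, a1, D1⟩ := gI.dat hI hI0 (hle.trans (Nat.le_succ _))
  obtain ⟨h1, b1, E1⟩ := gJ.dat hJ hJ0 (Nat.le_succ _)
  obtain ⟨p, l, c, e, G⟩ := exists_GL D.hom E.hom D.ne E.ne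
  obtain ⟨p1, l1, c1, e1, G1⟩ := exists_GL D1.hom E1.hom D1.ne E1.ne
  rw [full_iff hI hJ hI0 hJ0 gI gJ hle D E G]
  have hIJ : IsHomogeneousIdeal (I ⊓ J) := fun f hf d => ⟨hI f hf.1 d, hJ f hf.2 d⟩
  have hIJ0 : I ⊓ J ≠ ⊥ := by
    obtain ⟨u, hu, hu0⟩ := Submodule.exists_mem_ne_zero_of_ne_bot hI0
    obtain ⟨v, hv, hv0⟩ := Submodule.exists_mem_ne_zero_of_ne_bot hJ0
    intro hb
    have : u * v ∈ I ⊓ J := ⟨I.mul_mem_right _ hu, J.mul_mem_left _ hv⟩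
    rw [hb] at this
    exact mul_ne_zero hu0 hv0 this
  obtain ⟨f0, hf0, hf00, hf0d⟩ := exists_hom hIJ hIJ0
  have hge : ordDeg J ≤ ordDeg (I ⊓ J) := ord_le hf0.2 hf00 hf0d
  have hpos : 1 ≤ ordDeg J := by
    by_contra hlt
    obtain ⟨f, hf, hf0, hfd⟩ := exists_hom hJ hJ0
    have h0 : ordDeg J = 0 := by omega
    rw [h0, ← totalDegree_zero_iff_isHomogeneous, totalDegree_eq_zero_iff_eq_C] at hfd
    apply hJtop
    apply Ideal.eq_top_of_isUnit_mem _ hf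
    rw [hfd]
    refine IsUnit.map C (IsUnit.mk0 _ fun hc => hf0 ?_)
    rw [hfd, hc, map_zero]
  -- order of the intersection equals `ordDeg J` iff `e ≤ ordDeg J`
  have hcase1 : ordDeg (I ⊓ J) = ordDeg J ↔ e ≤ ordDeg J := by
    constructor
    · intro h1
      rw [h1] at hf0d
      exact dvd_deg hf0d hf00 G.hl
        (G.lcm _ ((D.iff _ hf0d).1 hf0.1) ((E.iff _ hf0d).1 hf0.2))
    · intro h1
      have hh := hom_X_pow G.hl h1 0
      refine le_antisymm (ord_le (I := I ⊓ J) ⟨(D.iff _ hh).2 (G.gl.mul_right _),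
        (E.iff _ hh).2 (G.hl'.mul_right _)⟩
        (mul_ne_zero G.hl0 (pow_ne_zero _ (X_ne_zero _))) hh) hge
  have hcase2 : ordDeg (I ⊓ J) ≤ ordDeg J + 1 ↔ e1 ≤ ordDeg J + 1 := by
    constructor
    · intro h1
      have hh := hom_X_pow hf0d h1 0
      have hh0 := mul_ne_zero hf00 (pow_ne_zero (ordDeg J + 1 - ordDeg (I ⊓ J)) (X_ne_zero (0 : Fin 2)))
      exact dvd_deg hh hh0 G1.hl (G1.lcm _ ((D1.iff _ hh).1 (I.mul_mem_right _ hf0.1))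
        ((E1.iff _ hh).1 (J.mul_mem_right _ hf0.2)))
    · intro h1
      have hh := hom_X_pow G1.hl h1 0
      exact ord_le (I := I ⊓ J) ⟨(D1.iff _ hh).2 (G1.gl.mul_right _),
        (E1.iff _ hh).2 (G1.hl'.mul_right _)⟩
        (mul_ne_zero G1.hl0 (pow_ne_zero _ (X_ne_zero _))) hh
  have he1 : e1 ≤ e := dvd_deg G.hl G.hl0 G1.hl
    (G1.lcm _ ((D.mono D1 (Nat.le_succ _)).trans G.gl) ((E.mono E1 (Nat.le_succ _)).trans G.hl'))
  rw [hcase1]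
  by_cases hcs : e ≤ ordDeg J
  · simp only [hcs, true_or, iff_true]; omega
  simp only [hcs, false_or]
  constructor
  · intro he
    have hee : e = ordDeg J + 1 := by omega
    have hne : ordDeg (I ⊓ J) ≠ ordDeg J := fun h => hcs (hcase1.1 h)
    have hle1 := hcase2.2 (he1.trans he)
    refine ⟨by omega, fun heq => ?_⟩
    obtain ⟨n, hn⟩ : ∃ n, ordDeg J = n + 1 := ⟨ordDeg J - 1, by omega⟩
    rw [hn] at D E
    have hDle := D.le
    have hEle := E.le
    have hbad := G.le_of_sup_eq (d := n) ?_ hDle hEle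
    · omega
    apply le_antisymm (G.sup_le _)
    intro f hf
    rw [mem_M] at hf
    have hfK : f ∈ Submodule.colon (I + J) (maxIdeal k) := by
      have : ∀ i, f * X i ∈ I + J := by
        intro i
        rw [sum_iff hI hJ D E (hom_mulX hf.1 i), G.sup_eq (by omega), mem_M]
        exact ⟨hom_mulX hf.1 i, hf.2.mul_right _⟩
      exact mem_colon_max.2 ⟨this 0, this 1⟩
    rw [heq] at hfK
    obtain ⟨u, hu, v, hv, hud, hvd, rfl⟩ := sum_decomp' (colon_hom hI) (colon_hom hJ) hfK hf.1
    rw [mem_colon_max] at hu hv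
    refine Submodule.add_mem_sup (mem_M.2 ⟨hud, dvd_of_dvd_X ?_ ?_⟩) (mem_M.2 ⟨hvd, dvd_of_dvd_X ?_ ?_⟩)
    · exact (D.iff _ (hom_mulX hud 0)).1 hu.1
    · exact (D.iff _ (hom_mulX hud 1)).1 hu.2
    · exact (E.iff _ (hom_mulX hvd 0)).1 hv.1
    · exact (E.iff _ (hom_mulX hvd 1)).1 hv.2
  · rintro ⟨ho, hneq⟩
    by_contra he
    push Not at he
    apply hneq
    have he1' := hcase2.1 ho.le
    apply le_antisymm
    · intro f hf
      apply mem_of_comp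
      intro d
      have hf := colon_hom (add_hom hI hJ) f hf d
      have hfd := homogeneousComponent_isHomogeneous d f
      generalize homogeneousComponent d f = f at *
      rw [mem_colon_max] at hf
      obtain ⟨u, hu, v, hv, hud, hvd, huv⟩ := sum_decomp' hI hJ hf.1 (hom_mulX hfd 0)
      obtain ⟨u', hu', v', hv', hud', hvd', huv'⟩ := sum_decomp' hI hJ hf.2 (hom_mulX hfd 1)
      rcases lt_trichotomy (d + 1) (ordDeg J) with hd | hd | hd
      · have : v = 0 := by
          by_contra h0
          exact absurd (ord_le hv h0 hvd) (by omega)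
        have : v' = 0 := by
          by_contra h0
          exact absurd (ord_le hv' h0 hvd') (by omega)
        subst v v'
        have : f ∈ Submodule.colon I (maxIdeal k) := by
          rw [mem_colon_max, huv, huv']
          simpa using ⟨hu, hu'⟩
        simpa using mem_add this (Submodule.zero_mem _)
      · rw [← hd] at D E
        have hz : u * X 1 - u' * X 0 = 0 := by
          by_contra h0
          have hh : (u * X 1 - u' * X 0).IsHomogeneous (d + 1 + 1) :=
            (hom_mulX hud 1).sub (hom_mulX hud' 0)
          have hl : l ∣ u * X 1 - u' * X 0 := by
            apply G.lcm
            · exact dvd_sub (((D.iff _ hud).1 hu).mul_right _) (((D.iff _ hud').1 hu').mul_right _)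
            · have : u * X 1 - u' * X 0 = v' * X 0 - v * X 1 := by
                linear_combination X 0 * huv' - X 1 * huv
              rw [this]
              exact dvd_sub (((E.iff _ hvd').1 hv').mul_right _) (((E.iff _ hvd).1 hv).mul_right _)
          have := dvd_deg hh h0 G.hl hl
          omega
        have hx : (X 0 : Rg k) ∣ u := by
          have : (X 0 : Rg k) ∣ u * X 1 := ⟨u', by linear_combination hz⟩
          exact (X_prime.dvd_or_dvd this).resolve_right X0_not_dvd
        obtain ⟨w, rfl⟩ := hx
        have hu'w : u' = w * X 1 := by
          apply mul_left_cancel₀ (X_ne_zero (R := k) (0 : Fin 2))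
          linear_combination -hz
        have h1 : w ∈ Submodule.colon I (maxIdeal k) := by
          rw [mem_colon_max, ← hu'w, mul_comm]
          exact ⟨hu, hu'⟩
        have h2 : f - w ∈ Submodule.colon J (maxIdeal k) := by
          rw [mem_colon_max]
          constructor
          · convert! hv using 1
            linear_combination huv
          · convert! hv' using 1
            linear_combination huv' + hu'w
        have := mem_add h1 h2
        rwa [add_sub_cancel] at this
      · obtain ⟨g', a', D'⟩ := gI.dat hI hI0 (d := d + 1) (by omega)
        obtain ⟨h', b', E'⟩ := gJ.dat hJ hJ0 (d := d + 1) (by omega)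
        obtain ⟨p', l', c', e', G'⟩ := exists_GL D'.hom E'.hom D'.ne E'.ne
        have he' : e' ≤ e1 := dvd_deg G1.hl G1.hl0 G'.hl
          (G'.lcm _ ((D1.mono D' (by omega)).trans G1.gl) ((E1.mono E' (by omega)).trans G1.hl'))
        have hpf : ∀ i, f * X i ∈ I + J → p' ∣ f * X i := by
          intro i hi
          rw [sum_iff hI hJ D' E' (hom_mulX hfd i)] at hi
          exact (mem_M.1 (G'.sup_le _ hi)).2
        have hp : f ∈ M p' d := mem_M.2 ⟨hfd, dvd_of_dvd_X (hpf 0 hf.1) (hpf 1 hf.2)⟩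
        rw [← G'.sup_eq (by omega)] at hp
        obtain ⟨s, hs, t, ht, rfl⟩ := Submodule.mem_sup.1 hp
        rw [mem_M] at hs ht
        refine mem_add (mem_colon_max.2 ⟨?_, ?_⟩) (mem_colon_max.2 ⟨?_, ?_⟩)
        · exact (D'.iff _ (hom_mulX hs.1 0)).2 (hs.2.mul_right _)
        · exact (D'.iff _ (hom_mulX hs.1 1)).2 (hs.2.mul_right _)
        · exact (E'.iff _ (hom_mulX ht.1 0)).2 (ht.2.mul_right _)
        · exact (E'.iff _ (hom_mulX ht.1 1)).2 (ht.2.mul_right _)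
    · intro f hf
      rw [Submodule.add_eq_sup] at hf
      obtain ⟨u, hu, v, hv, rfl⟩ := Submodule.mem_sup.1 hf
      rw [mem_colon_max] at hu hv ⊢
      rw [add_mul, add_mul]
      exact ⟨mem_add hu.1 hv.1, mem_add hu.2 hv.2⟩

end

end FullSum

theorem full_sum_iff {k : Type*} [Field k] [Infinite k]
    (I J : Ideal (MvPolynomial (Fin 2) k))
    (hI0 : I ≠ ⊥) (hItop : I ≠ ⊤) (hJ0 : J ≠ ⊥) (hJtop : J ≠ ⊤)
    (hIhom : IsHomogeneousIdeal I) (hJhom : IsHomogeneousIdeal J)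
    (hIfull : IsFull I) (hJfull : IsFull J) :
    IsFull (I + J) ↔
      ordDeg (I ⊓ J) = max (ordDeg I) (ordDeg J) ∨
      (ordDeg (I ⊓ J) = max (ordDeg I) (ordDeg J) + 1 ∧
        Submodule.colon (I + J) (maxIdeal k) ≠
          Submodule.colon I (maxIdeal k) + Submodule.colon J (maxIdeal k)) := by
  have gI := FullSum.full_good hIfull
  have gJ := FullSum.full_good hJfull
  rcases le_total (ordDeg I) (ordDeg J) with h | h
  · rw [max_eq_right h]
    exact FullSum.main_aux hIhom hJhom hI0 hJ0 hJtop gI gJ h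
  · rw [max_eq_left h, add_comm I J, inf_comm I J,
      add_comm (Submodule.colon I (maxIdeal k : Set (MvPolynomial (Fin 2) k)))]
    exact FullSum.main_aux hJhom hIhom hJ0 hI0 hItop gJ gI h

end
end

section
/- Let k be an infinite field and R = k[x,y] with homogeneous maximal ideal 𝔪 = (x,y). Let I and J be nonzero proper homogeneous ideals of R that are both full. Then there exists a linear form z ∈ R with (I : z) = (I : 𝔪) and (J : z) = (J : 𝔪) such that o(I ∩ J) = max{o(I), o(J)} + ℓ( ((I+J) : z) / ((I : 𝔪) + (J : 𝔪)) ), where ℓ denotes length as an R-module. -/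
open MvPolynomial

noncomputable section

variable {k : Type*} [Field k]

/-- The length of a module: the supremum of the lengths of strictly increasing
chains of submodules. -/
def modLength (R M : Type*) [Ring R] [AddCommGroup M] [Module R M] : ℕ∞ :=
  ⨆ p : LTSeries (Submodule R M), (p.length : ℕ∞)

lemma modLength_eq (R M : Type*) [Ring R] [AddCommGroup M] [Module R M] :
    modLength R M = Module.length R M := by
  apply WithBot.coe_injective
  rw [Module.coe_length, Order.krullDim_eq_iSup_length, modLength]

/-- restriction to the line through `(1,v)` -/
def restr (v : k) : MvPolynomial (Fin 2) k →ₐ[k] Polynomial k :=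
  MvPolynomial.aeval ![Polynomial.X, Polynomial.C v * Polynomial.X]

/-- the linear form vanishing at `(1,v)` -/
def lform (v : k) : MvPolynomial (Fin 2) k := X 1 - C v * X 0

/-- the ideal `(z, x^n)` -/
def Mid (v : k) (n : ℕ) : Ideal (MvPolynomial (Fin 2) k) :=
  Ideal.comap (restr v) (Ideal.span {Polynomial.X ^ n})

lemma mem_Mid (v : k) (n : ℕ) (f : MvPolynomial (Fin 2) k) :
    f ∈ Mid v n ↔ Polynomial.X ^ n ∣ restr v f := by
  rw [Mid, Ideal.mem_comap, Ideal.mem_span_singleton]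

lemma restr_X0 (v : k) : restr v (X 0) = Polynomial.X := by simp [restr]

lemma restr_lform (v : k) : restr v (lform v) = 0 := by
  simp [restr, lform, MvPolynomial.algebraMap_eq]

lemma lform_hom (v : k) : (lform v).IsHomogeneous 1 :=
  (isHomogeneous_X k 1).sub (by simpa using (isHomogeneous_C_mul_X (R := k) v (0 : Fin 2)))

lemma lform_ne (v : k) : lform v ≠ 0 := by
  intro h
  have := congrArg (MvPolynomial.eval ![0, 1]) h
  simp [lform] at this

lemma restr_hom (v : k) {p : MvPolynomial (Fin 2) k} {d : ℕ} (hp : p.IsHomogeneous d) :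
    restr v p = Polynomial.C (MvPolynomial.eval ![1, v] p) * Polynomial.X ^ d := by
  rw [restr, aeval_def, eval₂_eq', eval_eq', map_sum, Finset.sum_mul]
  refine Finset.sum_congr rfl fun m hm => ?_
  have hd : m 0 + m 1 = d := by
    have := hp.degree_eq_sum_deg_support hm
    rw [Finset.sum_subset (Finset.subset_univ m.support)
      (fun i _ hi => Finsupp.notMem_support_iff.1 hi), Fin.sum_univ_two] at this
    exact this.symm
  simp only [Fin.prod_univ_two, Matrix.cons_val_zero, Matrix.cons_val_one, one_pow, one_mul,
    map_mul, map_pow, Polynomial.algebraMap_eq, mul_pow]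
  rw [← hd, pow_add]; ring

lemma restr_ker (v : k) (f : MvPolynomial (Fin 2) k) (hf : restr v f = 0) :
    lform v ∣ f := by
  let q := Ideal.Quotient.mkₐ k (Ideal.span {lform v})
  let ι : Polynomial k →ₐ[k] MvPolynomial (Fin 2) k := Polynomial.aeval (X 0)
  have h : (q.comp ι).comp (restr v) = q := by
    apply MvPolynomial.algHom_ext
    intro i
    fin_cases i
    · simp [restr, ι]
    · simp only [restr, ι, AlgHom.comp_apply, aeval_X, Fin.mk_one, Matrix.cons_val_one,
        Matrix.cons_val_zero]
      symm
      simp only [q, Ideal.Quotient.mkₐ_eq_mk]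
      rw [Ideal.Quotient.eq]
      simp [lform, MvPolynomial.algebraMap_eq, Ideal.mem_span_singleton]
  have h2 := DFunLike.congr_fun h f
  simp only [AlgHom.comp_apply, hf, map_zero] at h2
  rw [← Ideal.mem_span_singleton, ← Ideal.Quotient.eq_zero_iff_mem]
  exact h2.symm

lemma restr_surj (v : k) : Function.Surjective (restr v) := by
  intro g
  refine ⟨Polynomial.aeval (X 0) g, ?_⟩
  rw [← AlgHom.comp_apply]
  have : (restr v).comp (Polynomial.aeval (X 0)) = AlgHom.id k _ := by
    apply Polynomial.algHom_ext
    simp [restr_X0]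
  rw [this]; rfl

lemma hc_mul {z f : MvPolynomial (Fin 2) k} (hz : z.IsHomogeneous 1) (d : ℕ) :
    homogeneousComponent (d + 1) (z * f) = z * homogeneousComponent d f := by
  conv_lhs => rw [← sum_homogeneousComponent f, Finset.mul_sum, map_sum]
  have h : ∀ i, homogeneousComponent (d + 1) (z * homogeneousComponent i f) =
      if i = d then z * homogeneousComponent i f else 0 := by
    intro i
    have := (hz.mul (homogeneousComponent_isHomogeneous i f))
    rw [homogeneousComponent_of_mem ((mem_homogeneousSubmodule _ _).2 this)]
    by_cases hi : i = d
    · subst hi; simp [add_comm]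
    · have : d + 1 ≠ 1 + i := by omega
      simp [hi, this]
  simp only [h, Finset.sum_ite_eq', Finset.mem_range]
  split_ifs with h1
  · rfl
  · rw [homogeneousComponent_eq_zero _ _ (by omega), mul_zero]

/-! ### order -/

lemma ord_exists {I : Ideal (MvPolynomial (Fin 2) k)} (h0 : I ≠ ⊥) (hI : IsHomogeneousIdeal I) :
    ∃ p ∈ I, p ≠ 0 ∧ p.IsHomogeneous (ordDeg I) := by
  have : {d : ℕ | ∃ p ∈ I, p ≠ 0 ∧ MvPolynomial.IsHomogeneous p d}.Nonempty := by
    obtain ⟨f, hf, hf0⟩ := Submodule.exists_mem_ne_zero_of_ne_bot h0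
    have : ∃ d, homogeneousComponent d f ≠ 0 := by
      by_contra! h
      apply hf0
      rw [← sum_homogeneousComponent f]
      exact Finset.sum_eq_zero fun i _ => h i
    obtain ⟨d, hd⟩ := this
    exact ⟨d, _, hI f hf d, hd, homogeneousComponent_isHomogeneous _ _⟩
  exact Nat.sInf_mem this

lemma ord_le {I : Ideal (MvPolynomial (Fin 2) k)} {p : MvPolynomial (Fin 2) k} {d : ℕ}
    (hp : p ∈ I) (h0 : p ≠ 0) (hd : p.IsHomogeneous d) : ordDeg I ≤ d :=
  Nat.sInf_le ⟨p, hp, h0, hd⟩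

/-- Good points: some form of least degree does not vanish. -/
def Good (I : Ideal (MvPolynomial (Fin 2) k)) (v : k) : Prop :=
  ∃ p ∈ I, p.IsHomogeneous (ordDeg I) ∧ MvPolynomial.eval ![1, v] p ≠ 0

lemma sup_eq_Mid {I : Ideal (MvPolynomial (Fin 2) k)} (hI : IsHomogeneousIdeal I) {v : k}
    (hg : Good I v) : I ⊔ Ideal.span {lform v} = Mid v (ordDeg I) := by
  apply le_antisymm
  · apply sup_le
    · intro f hf
      rw [mem_Mid, ← sum_homogeneousComponent f, map_sum]
      apply Finset.dvd_sum
      intro i _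
      by_cases h : homogeneousComponent i f = 0
      · rw [h, map_zero]; exact dvd_zero _
      · have hh := homogeneousComponent_isHomogeneous i f
        rw [restr_hom v hh]
        exact Dvd.dvd.mul_left (pow_dvd_pow _ (ord_le (hI f hf i) h hh)) _
    · rw [Ideal.span_singleton_le_iff_mem, mem_Mid, restr_lform]
      exact dvd_zero _
  · intro f hf
    rw [mem_Mid] at hf
    obtain ⟨g, hg'⟩ := hf
    obtain ⟨p, hpI, hph, hpe⟩ := hg
    obtain ⟨g', rfl⟩ := restr_surj v g
    have : lform v ∣ f - p * (C (MvPolynomial.eval ![1, v] p)⁻¹ * g') := by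
      apply restr_ker
      rw [map_sub, map_mul, map_mul, restr_hom v hph, hg']
      have : restr v (C (MvPolynomial.eval ![1, v] p)⁻¹) =
          Polynomial.C (MvPolynomial.eval ![1, v] p)⁻¹ := by
        simp [restr]
      rw [this]
      have h1 : Polynomial.C (MvPolynomial.eval ![1, v] p) *
        Polynomial.C (MvPolynomial.eval ![1, v] p)⁻¹ = 1 := by
        rw [← Polynomial.C_mul, mul_inv_cancel₀ hpe, Polynomial.C_1]
      linear_combination (- Polynomial.X ^ (ordDeg I) * restr v g') * h1
    rw [← sub_add_cancel f (p * (C (MvPolynomial.eval ![1, v] p)⁻¹ * g')), add_comm]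
    exact Submodule.add_mem_sup (Ideal.mul_mem_right _ _ hpI) (Ideal.mem_span_singleton.2 this)

lemma exists_good [Infinite k] (p q r : MvPolynomial (Fin 2) k) {a b c : ℕ}
    (hp : p.IsHomogeneous a) (hq : q.IsHomogeneous b) (hr : r.IsHomogeneous c)
    (hp0 : p ≠ 0) (hq0 : q ≠ 0) (hr0 : r ≠ 0) :
    ∃ v : k, MvPolynomial.eval ![1, v] p ≠ 0 ∧ MvPolynomial.eval ![1, v] q ≠ 0 ∧
      MvPolynomial.eval ![1, v] r ≠ 0 := by
  have hF : p * q * r * X 0 ≠ 0 :=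
    mul_ne_zero (mul_ne_zero (mul_ne_zero hp0 hq0) hr0) (X_ne_zero _)
  have : ∃ y : Fin 2 → k, MvPolynomial.eval y (p * q * r * X 0) ≠ 0 := by
    by_contra! h
    exact hF (MvPolynomial.funext fun y => by rw [h y, map_zero])
  obtain ⟨y, hy⟩ := this
  simp only [map_mul, eval_X] at hy
  have hy0 : y 0 ≠ 0 := right_ne_zero_of_mul hy
  have key : ∀ {p : MvPolynomial (Fin 2) k} {d : ℕ}, p.IsHomogeneous d →
      MvPolynomial.eval y p ≠ 0 → MvPolynomial.eval ![1, y 1 / y 0] p ≠ 0 := by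
    intro p d hp h h0
    apply h
    have h1 := congrArg (Polynomial.eval (y 0)) (restr_hom (y 1 / y 0) hp)
    rw [h0] at h1
    simp only [map_zero, zero_mul, Polynomial.eval_zero] at h1
    rw [← h1, restr, ← Polynomial.coe_aeval_eq_eval]
    have : ((Polynomial.aeval (y 0)).comp (MvPolynomial.aeval
        ![Polynomial.X, Polynomial.C (y 1 / y 0) * Polynomial.X])) = MvPolynomial.aeval y := by
      apply MvPolynomial.algHom_ext
      intro i
      fin_cases i
      · simp
      · simp [hy0]
    have h2 := DFunLike.congr_fun this p
    rw [MvPolynomial.aeval_eq_eval] at h2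
    exact h2.symm
  have h1 := left_ne_zero_of_mul hy
  have h2 := left_ne_zero_of_mul h1
  exact ⟨y 1 / y 0, key hp (left_ne_zero_of_mul h2), key hq (right_ne_zero_of_mul h2),
    key hr (right_ne_zero_of_mul h1)⟩

/-! ### colon -/

lemma mem_colon_z (I : Ideal (MvPolynomial (Fin 2) k)) (z f : MvPolynomial (Fin 2) k) :
    f ∈ Submodule.colon I (Ideal.span {z} : Set (MvPolynomial (Fin 2) k)) ↔ z * f ∈ I := by
  rw [Submodule.mem_colon]
  constructor
  · intro h
    have := h z (Ideal.mem_span_singleton_self z)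
    rwa [smul_eq_mul, mul_comm] at this
  · intro h s hs
    obtain ⟨c, rfl⟩ := Ideal.mem_span_singleton.1 hs
    have : f • (z * c) = c * (z * f) := by simp only [smul_eq_mul]; ring
    rw [this]
    exact I.mul_mem_left _ h

lemma hom_one_mem {z : MvPolynomial (Fin 2) k} (hz : z.IsHomogeneous 1) : z ∈ maxIdeal k := by
  have h := (mem_homogeneousSubmodule 1 z).2 hz
  rw [homogeneousSubmodule_one_eq_span_X] at h
  clear hz
  induction h using Submodule.span_induction with
  | mem x hx =>
    obtain ⟨i, rfl⟩ := hx
    apply Ideal.subset_span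
    fin_cases i <;> simp
  | zero => exact zero_mem _
  | add x y _ _ hx hy => exact add_mem hx hy
  | smul a x _ hx => rw [MvPolynomial.smul_eq_C_mul]; exact Ideal.mul_mem_left _ _ hx

lemma colon_m_le {I : Ideal (MvPolynomial (Fin 2) k)} {z : MvPolynomial (Fin 2) k}
    (hz : z.IsHomogeneous 1) :
    Submodule.colon I (maxIdeal k : Set (MvPolynomial (Fin 2) k)) ≤
      Submodule.colon I (Ideal.span {z} : Set (MvPolynomial (Fin 2) k)) := by
  intro f hf
  rw [mem_colon_z, mul_comm]
  exact Submodule.mem_colon.1 hf z (hom_one_mem hz)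

/-- Linear algebra core. -/
lemma core {K W W' : Type*} [Field K] [AddCommGroup W] [Module K W] [AddCommGroup W'] [Module K W']
    [FiniteDimensional K W] [FiniteDimensional K W'] (m m₀ : W →ₗ[K] W')
    (hm : Function.Injective m) (hm₀ : Function.Injective m₀) (N : Submodule K W')
    (hN : ¬ N ≤ LinearMap.range m)
    (hdim : Module.finrank K W' ≤ Module.finrank K W + 1)
    (hle : N.comap m₀ ≤ N.comap m) : N.comap m₀ = N.comap m := by
  apply Submodule.eq_of_le_of_finrank_le hle
  have e : ∀ (f : W →ₗ[K] W'), Function.Injective f →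
      Module.finrank K (N.comap f) = Module.finrank K ↥(LinearMap.range f ⊓ N) := by
    intro f hf
    rw [← Submodule.map_comap_eq]
    exact (Submodule.equivMapOfInjective f hf _).finrank_eq
  rw [e m hm, e m₀ hm₀]
  have h1 : Module.finrank K ↥(LinearMap.range m ⊓ N) < Module.finrank K N := by
    apply Submodule.finrank_lt_finrank_of_lt
    refine lt_of_le_of_ne inf_le_right fun h => hN ?_
    rw [← h]; exact inf_le_left
  have h2 := Submodule.finrank_sup_add_finrank_inf_eq (LinearMap.range m₀) N
  have h3 := LinearMap.finrank_range_of_inj hm₀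
  have h4 := Submodule.finrank_le (LinearMap.range m₀ ⊔ N)
  omega

/-- multiplication by a linear form on homogeneous polynomials -/
def mulZ (z : MvPolynomial (Fin 2) k) (hz : z.IsHomogeneous 1) (d : ℕ) :
    homogeneousSubmodule (Fin 2) k d →ₗ[k] homogeneousSubmodule (Fin 2) k (d + 1) :=
  ((LinearMap.mulLeft k z).comp (Submodule.subtype _)).codRestrict _ (fun f => by
    rw [mem_homogeneousSubmodule]
    have := hz.mul ((mem_homogeneousSubmodule _ _).1 f.2)
    rw [add_comm]; exact this)

lemma mulZ_coe (z : MvPolynomial (Fin 2) k) (hz : z.IsHomogeneous 1) (d : ℕ)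
    (f : homogeneousSubmodule (Fin 2) k d) :
    (mulZ z hz d f : MvPolynomial (Fin 2) k) = z * (f : MvPolynomial (Fin 2) k) := rfl

lemma mulZ_inj (z : MvPolynomial (Fin 2) k) (hz : z.IsHomogeneous 1) (h0 : z ≠ 0) (d : ℕ) :
    Function.Injective (mulZ z hz d) := by
  intro f g h
  have := congrArg Subtype.val h
  rw [mulZ_coe, mulZ_coe] at this
  exact Subtype.ext (mul_left_cancel₀ h0 this)

instance fdHom (d : ℕ) : FiniteDimensional k (homogeneousSubmodule (Fin 2) k d) :=
  Module.Finite.iff_fg.2 (homogeneousSubmodule_fg (Fin 2) k d)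

lemma dim_hom (v : k) (d : ℕ) : Module.finrank k (homogeneousSubmodule (Fin 2) k (d + 1)) ≤
    Module.finrank k (homogeneousSubmodule (Fin 2) k d) + 1 := by
  have hx : (X 0 ^ (d + 1) : MvPolynomial (Fin 2) k) ∈ homogeneousSubmodule (Fin 2) k (d + 1) :=
    (mem_homogeneousSubmodule _ _).2 (isHomogeneous_X_pow _ _)
  let xd : homogeneousSubmodule (Fin 2) k (d + 1) := ⟨X 0 ^ (d + 1), hx⟩
  have htop : LinearMap.range (mulZ (lform v) (lform_hom v) d) ⊔ Submodule.span k {xd} = ⊤ := by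
    rw [eq_top_iff]
    rintro ⟨f, hf⟩ -
    rw [mem_homogeneousSubmodule] at hf
    have h1 : lform v ∣ f - C (MvPolynomial.eval ![1, v] f) * X 0 ^ (d + 1) := by
      apply restr_ker
      rw [map_sub, map_mul, map_pow, restr_X0, restr_hom v hf]
      simp [restr]
    obtain ⟨g, hg⟩ := h1
    have h2 : f - C (MvPolynomial.eval ![1, v] f) * X 0 ^ (d + 1) =
        lform v * homogeneousComponent d g := by
      rw [← hc_mul (lform_hom v), ← hg]
      symm
      apply homogeneousComponent_eq_self
      exact hf.sub (by simpa using (isHomogeneous_X_pow (R := k) (0 : Fin 2) (d+1)).C_mul _)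
    have : (⟨f, hf⟩ : homogeneousSubmodule (Fin 2) k (d + 1)) =
        mulZ (lform v) (lform_hom v) d ⟨homogeneousComponent d g, homogeneousComponent_mem _ _⟩ +
        (MvPolynomial.eval ![1, v] f) • xd := by
      apply Subtype.ext
      rw [Submodule.coe_add, mulZ_coe, Submodule.coe_smul, ← h2, MvPolynomial.smul_eq_C_mul]
      simp [xd]
    rw [this]
    exact Submodule.add_mem_sup (LinearMap.mem_range_self _ _)
      (Submodule.smul_mem _ _ (Submodule.mem_span_singleton_self _))
  have h1 := Submodule.finrank_add_le_finrank_add_finrank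
    (LinearMap.range (mulZ (lform v) (lform_hom v) d)) (Submodule.span k {xd})
  rw [htop, finrank_top, LinearMap.finrank_range_of_inj (mulZ_inj _ _ (lform_ne v) d)] at h1
  have h2 : Module.finrank k (Submodule.span k {xd}) ≤ 1 := by
    simpa using finrank_span_le_card (R := k) ({xd} : Set _)
  omega

lemma full_good {I : Ideal (MvPolynomial (Fin 2) k)} (hI : IsHomogeneousIdeal I)
    (hfull : IsFull I) {v : k} (hg : Good I v) :
    Submodule.colon I (Ideal.span {lform v} : Set (MvPolynomial (Fin 2) k)) =
      Submodule.colon I (maxIdeal k : Set (MvPolynomial (Fin 2) k)) := by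
  refine le_antisymm ?_ (colon_m_le (lform_hom v))
  obtain ⟨z₀, hz0, hz, hcol⟩ := hfull
  intro f hf
  rw [mem_colon_z] at hf
  rw [← sum_homogeneousComponent f]
  refine Submodule.sum_mem _ fun d _ => ?_
  have hfd : lform v * homogeneousComponent d f ∈ I := by
    rw [← hc_mul (lform_hom v)]; exact hI _ hf _
  rw [← hcol, mem_colon_z]
  by_cases hd : d + 1 < ordDeg I
  · have : lform v * homogeneousComponent d f = 0 := by
      by_contra h
      have := ord_le hfd h ((lform_hom v).mul (homogeneousComponent_isHomogeneous d f))
      omega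
    rw [(mul_eq_zero.1 this).resolve_left (lform_ne v), mul_zero]
    exact zero_mem _
  · push Not at hd
    let N : Submodule k (homogeneousSubmodule (Fin 2) k (d + 1)) :=
      (I.restrictScalars k).comap (Submodule.subtype _)
    have hc := core (mulZ (lform v) (lform_hom v) d) (mulZ z₀ hz d) (mulZ_inj _ _ (lform_ne v) d)
      (mulZ_inj _ _ hz0 d) N ?_ (dim_hom v d) ?_
    · have : (⟨homogeneousComponent d f, homogeneousComponent_mem _ _⟩ :
          homogeneousSubmodule (Fin 2) k d) ∈ N.comap (mulZ (lform v) (lform_hom v) d) := hfd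
      rw [← hc] at this
      exact this
    · intro hle
      obtain ⟨p, hpI, hph, hpe⟩ := hg
      have hq : (X 0 ^ (d + 1 - ordDeg I) * p).IsHomogeneous (d + 1) := by
        have := (isHomogeneous_X_pow (R := k) (0 : Fin 2) (d + 1 - ordDeg I)).mul hph
        rwa [Nat.sub_add_cancel hd] at this
      obtain ⟨g, hg⟩ := hle (show (⟨_, (mem_homogeneousSubmodule _ _).2 hq⟩ :
        homogeneousSubmodule (Fin 2) k (d + 1)) ∈ N from I.mul_mem_left _ hpI)
      have h1 := congrArg Subtype.val hg
      rw [mulZ_coe] at h1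
      have h2 := congrArg (MvPolynomial.eval ![1, v]) h1
      simp [lform] at h2
      exact hpe h2.symm
    · rintro ⟨g, hgd⟩ hgm
      have : g ∈ Submodule.colon I (Ideal.span {z₀} : Set (MvPolynomial (Fin 2) k)) :=
        (mem_colon_z _ _ _).2 hgm
      rw [hcol] at this
      exact (mem_colon_z _ _ _).1 (colon_m_le (lform_hom v) this)

/-! ### lengths -/

lemma lform_mem_Mid (v : k) (n : ℕ) : lform v ∈ Mid v n := by
  rw [mem_Mid, restr_lform]; exact dvd_zero _

lemma Mid_zero (v : k) : Mid v 0 = ⊤ := by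
  rw [eq_top_iff]; intro f _; rw [mem_Mid]; simp

lemma Mid_anti (v : k) {a b : ℕ} (h : a ≤ b) : Mid v b ≤ Mid v a := by
  intro f; rw [mem_Mid, mem_Mid]; exact fun hf => (pow_dvd_pow _ h).trans hf

lemma Mid_le_iff (v : k) {a b : ℕ} (h : Mid v b ≤ Mid v a) : a ≤ b := by
  have : (X 0 ^ b : MvPolynomial (Fin 2) k) ∈ Mid v b := by
    rw [mem_Mid, map_pow, restr_X0]
  have := h this
  rw [mem_Mid, map_pow, restr_X0] at this
  exact (pow_dvd_pow_iff Polynomial.X_ne_zero Polynomial.not_isUnit_X).1 this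

lemma Mid_inf (v : k) (a b : ℕ) : Mid v a ⊓ Mid v b = Mid v (max a b) := by
  rcases le_total a b with h | h
  · rw [max_eq_right h, inf_eq_right]; exact Mid_anti v h
  · rw [max_eq_left h, inf_eq_left]; exact Mid_anti v h

lemma Mid_one_max (v : k) : (Mid v 1).IsMaximal := by
  have : Mid v 1 = RingHom.ker (Polynomial.constantCoeff.comp (restr v : _ →+* Polynomial k)) := by
    ext f
    rw [mem_Mid, pow_one, Polynomial.X_dvd_iff, RingHom.mem_ker]; rfl
  rw [this]
  apply RingHom.ker_isMaximal_of_surjective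
  intro c
  exact ⟨C c, by simp [restr]⟩

lemma length_Mid (v : k) (n : ℕ) :
    Module.length (MvPolynomial (Fin 2) k) (MvPolynomial (Fin 2) k ⧸ Mid v n) = n := by
  induction n with
  | zero =>
    rw [Nat.cast_zero, Module.length_eq_zero_iff, Submodule.Quotient.subsingleton_iff]
    exact Mid_zero v
  | succ n ih =>
    have hle : Mid v n ≤ Submodule.comap
        (LinearMap.mulLeft (MvPolynomial (Fin 2) k) (X 0 : MvPolynomial (Fin 2) k))
        (Mid v (n + 1)) := by
      intro f hf
      rw [Submodule.mem_comap, LinearMap.mulLeft_apply, mem_Mid, map_mul, restr_X0, pow_succ']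
      exact mul_dvd_mul_left _ ((mem_Mid _ _ _).1 hf)
    let F := Submodule.mapQ (Mid v n) (Mid v (n + 1)) _ hle
    let G := Submodule.factor (Mid_anti v (Nat.le_add_left 1 n))
    have hF : Function.Injective F := by
      rw [← LinearMap.ker_eq_bot, LinearMap.ker_eq_bot']
      intro m hm
      obtain ⟨f, rfl⟩ := Submodule.Quotient.mk_surjective _ m
      rw [Submodule.mapQ_apply, Submodule.Quotient.mk_eq_zero, LinearMap.mulLeft_apply, mem_Mid,
        map_mul, restr_X0, pow_succ'] at hm
      rw [Submodule.Quotient.mk_eq_zero, mem_Mid]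
      exact (mul_dvd_mul_iff_left Polynomial.X_ne_zero).1 hm
    have hG : Function.Surjective G := Submodule.factor_surjective _
    have hex : Function.Exact F G := by
      intro m
      obtain ⟨f, rfl⟩ := Submodule.Quotient.mk_surjective _ m
      have hGf : G (Submodule.Quotient.mk f) = Submodule.Quotient.mk f := rfl
      rw [hGf, Submodule.Quotient.mk_eq_zero, mem_Mid, pow_one]
      constructor
      · rintro ⟨g, hg⟩
        obtain ⟨g', rfl⟩ := restr_surj v g
        refine ⟨Submodule.Quotient.mk g', ?_⟩
        rw [Submodule.mapQ_apply, LinearMap.mulLeft_apply, Submodule.Quotient.eq, mem_Mid, map_sub,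
          map_mul, restr_X0, hg, sub_self]
        exact dvd_zero _
      · rintro ⟨m, hm⟩
        obtain ⟨g, rfl⟩ := Submodule.Quotient.mk_surjective _ m
        rw [Submodule.mapQ_apply, LinearMap.mulLeft_apply, Submodule.Quotient.eq, mem_Mid, map_sub,
          map_mul, restr_X0] at hm
        have h1 : Polynomial.X ∣ Polynomial.X * restr v g - restr v f :=
          (dvd_pow_self _ (Nat.succ_ne_zero n)).trans hm
        exact (dvd_sub_right (dvd_mul_right _ _)).1 h1
    rw [Module.length_eq_add_of_exact F G hF hG hex, ih]
    have : IsSimpleModule (MvPolynomial (Fin 2) k) (MvPolynomial (Fin 2) k ⧸ Mid v 1) := by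
      rw [isSimpleModule_iff_isCoatom]
      exact (Mid_one_max v).out
    rw [Module.length_eq_one]
    push_cast; rfl

/-- The auxiliary module of pairs `(a,i)` with `i ∈ I`, `z a - i ∈ J`. -/
def pairs {R : Type*} [CommRing R] (I J : Ideal R) (z : R) : Submodule R (R × R) where
  carrier := {w | w.2 ∈ I ∧ z * w.1 - w.2 ∈ J}
  zero_mem' := by simp
  add_mem' := by
    rintro a b ⟨h1, h2⟩ ⟨h3, h4⟩
    refine ⟨add_mem h1 h3, ?_⟩
    have := add_mem h2 h4
    convert this using 1
    simp only [Prod.fst_add, Prod.snd_add]; ring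
  smul_mem' := by
    rintro c a ⟨h1, h2⟩
    refine ⟨I.mul_mem_left _ h1, ?_⟩
    have := J.mul_mem_left c h2
    convert this using 1
    simp only [Prod.smul_fst, Prod.smul_snd, smul_eq_mul]; ring

lemma snake {R : Type*} [CommRing R] (I J : Ideal R) (z : R) (Cz CI CJ : Ideal R)
    (hCz : ∀ f, f ∈ Cz ↔ z * f ∈ I + J) (hCI : ∀ f, f ∈ CI ↔ z * f ∈ I)
    (hCJ : ∀ f, f ∈ CJ ↔ z * f ∈ J) (A B : Ideal R)
    (hA : A = (I ⊔ Ideal.span {z}) ⊓ (J ⊔ Ideal.span {z}))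
    (hB : B = (I ⊓ J) ⊔ Ideal.span {z}) :
    Module.length R (↥Cz ⧸ Submodule.comap Cz.subtype (CI + CJ)) +
      Module.length R (R ⧸ A) = Module.length R (R ⧸ B) := by
  have hzB : z ∈ B := hB ▸ Ideal.mem_sup_right (Ideal.mem_span_singleton_self z)
  have hBA : B ≤ A := by
    rw [hA, hB]
    exact le_inf (sup_le_sup_right inf_le_left _) (sup_le_sup_right inf_le_right _)
  let S := pairs I J z
  have hmem : ∀ w : S, w.1.1 ∈ Cz := by
    rintro ⟨⟨a, i⟩, h1, h2⟩
    rw [hCz]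
    have := Submodule.add_mem_sup h1 h2
    simpa using this
  let f0 : S →ₗ[R] Cz := ((LinearMap.fst R R R).comp S.subtype).codRestrict _ hmem
  let f : S →ₗ[R] (↥Cz ⧸ Submodule.comap Cz.subtype (CI + CJ)) := (Submodule.mkQ _).comp f0
  let g : S →ₗ[R] (R ⧸ B) := (Submodule.mkQ B).comp ((LinearMap.snd R R R).comp S.subtype)
  have hf : Function.Surjective f := by
    apply (Submodule.mkQ_surjective _).comp
    rintro ⟨a, ha⟩
    obtain ⟨i, hi, j, hj, hij⟩ := Submodule.mem_sup.1 ((hCz a).1 ha)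
    exact ⟨⟨(a, i), hi, by simpa [← hij] using hj⟩, rfl⟩
  have hker : LinearMap.ker f = LinearMap.ker g := by
    ext ⟨⟨a, i⟩, h1, h2⟩
    have e1 : (⟨⟨a, i⟩, h1, h2⟩ : S) ∈ LinearMap.ker f ↔ a ∈ CI + CJ := by
      rw [LinearMap.mem_ker]
      exact Submodule.Quotient.mk_eq_zero _
    have e2 : (⟨⟨a, i⟩, h1, h2⟩ : S) ∈ LinearMap.ker g ↔ i ∈ B := by
      rw [LinearMap.mem_ker]
      exact Submodule.Quotient.mk_eq_zero _
    simp only at h1 h2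
    rw [e1, e2, hB]
    constructor
    · intro h
      obtain ⟨b, hb, c, hc, rfl⟩ := Submodule.mem_sup.1 h
      rw [hCI] at hb
      rw [hCJ] at hc
      have : i = (i - z * b) + z * b := by ring
      rw [this]
      refine Submodule.add_mem_sup ⟨sub_mem h1 hb, ?_⟩
        (Ideal.mem_span_singleton.2 (dvd_mul_right _ _))
      change i - z * b ∈ J
      have := sub_mem hc h2
      convert this using 1
      ring
    · intro h
      obtain ⟨c, hc, y, hy, hcy⟩ := Submodule.mem_sup.1 h
      obtain ⟨b, rfl⟩ := Ideal.mem_span_singleton.1 hy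
      have : a = b + (a - b) := by ring
      rw [this]
      refine Submodule.add_mem_sup ((hCI _).2 ?_) ((hCJ _).2 ?_)
      · have := sub_mem h1 hc.1
        rwa [← hcy, add_sub_cancel_left] at this
      · have := add_mem h2 hc.2
        convert this using 1
        rw [← hcy]; ring
  let G := Submodule.factor hBA
  have hex : Function.Exact (LinearMap.range g).subtype G := by
    intro m
    obtain ⟨u, rfl⟩ := Submodule.Quotient.mk_surjective _ m
    have hGf : G (Submodule.Quotient.mk u) = Submodule.Quotient.mk u := rfl
    rw [hGf, Submodule.Quotient.mk_eq_zero, Submodule.coe_subtype, Subtype.range_coe]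
    constructor
    · intro hu
      rw [hA] at hu
      obtain ⟨hu1, hu2⟩ := hu
      obtain ⟨i, hi, y, hy, rfl⟩ := Submodule.mem_sup.1 hu1
      obtain ⟨b, rfl⟩ := Ideal.mem_span_singleton.1 hy
      obtain ⟨j, hj, y, hy', hjy⟩ := Submodule.mem_sup.1 hu2
      obtain ⟨c, rfl⟩ := Ideal.mem_span_singleton.1 hy'
      refine ⟨⟨(c - b, i), hi, ?_⟩, ?_⟩
      · have : z * (c - b) - i = - j := by linear_combination hjy
        simp only [this]
        exact neg_mem hj
      · change Submodule.Quotient.mk i = _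
        rw [Submodule.Quotient.eq, sub_add_cancel_left]
        exact neg_mem (B.mul_mem_right _ hzB)
    · rintro ⟨⟨⟨a, i⟩, h1, h2⟩, h⟩
      change Submodule.Quotient.mk i = _ at h
      rw [Submodule.Quotient.eq] at h
      have h3 := hBA h
      have : i ∈ A := by
        rw [hA]
        refine ⟨Ideal.mem_sup_left h1, ?_⟩
        have : i = -(z * a - i) + z * a := by ring
        rw [this]
        exact Submodule.add_mem_sup (neg_mem h2) (Ideal.mem_span_singleton.2 (dvd_mul_right _ _))
      have := sub_mem this h3
      simpa using this
  rw [Module.length_eq_add_of_exact _ G (Submodule.subtype_injective _)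
    (Submodule.factor_surjective _) hex]
  congr 1
  exact ((f.quotKerEquivOfSurjective hf).symm.trans
    ((Submodule.quotEquivOfEq _ _ hker).trans g.quotKerEquivRange)).length_eq

theorem order_of_intersection_formula {k : Type*} [Field k] [Infinite k]
    (I J : Ideal (MvPolynomial (Fin 2) k))
    (hI0 : I ≠ ⊥) (hItop : I ≠ ⊤) (hJ0 : J ≠ ⊥) (hJtop : J ≠ ⊤)
    (hIhom : IsHomogeneousIdeal I) (hJhom : IsHomogeneousIdeal J)
    (hIfull : IsFull I) (hJfull : IsFull J) :
    ∃ z : MvPolynomial (Fin 2) k, z ≠ 0 ∧ z.IsHomogeneous 1 ∧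
      Submodule.colon I (Ideal.span {z}) = Submodule.colon I (maxIdeal k) ∧
      Submodule.colon J (Ideal.span {z}) = Submodule.colon J (maxIdeal k) ∧
      ∃ l : ℕ,
        modLength (MvPolynomial (Fin 2) k)
          (↥(Submodule.colon (I + J) (Ideal.span {z})) ⧸
            Submodule.comap (Submodule.colon (I + J) (Ideal.span {z})).subtype
              (Submodule.colon I (maxIdeal k) + Submodule.colon J (maxIdeal k))) = l ∧
        ordDeg (I ⊓ J) = max (ordDeg I) (ordDeg J) + l := by
  have hIJ0 : I ⊓ J ≠ ⊥ := by
    obtain ⟨p, hp, hp0⟩ := Submodule.exists_mem_ne_zero_of_ne_bot hI0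
    obtain ⟨q, hq, hq0⟩ := Submodule.exists_mem_ne_zero_of_ne_bot hJ0
    exact (Submodule.ne_bot_iff _).2
      ⟨p * q, ⟨I.mul_mem_right _ hp, J.mul_mem_left _ hq⟩, mul_ne_zero hp0 hq0⟩
  have hIJhom : IsHomogeneousIdeal (I ⊓ J) := fun p hp d => ⟨hIhom p hp.1 d, hJhom p hp.2 d⟩
  obtain ⟨p, hpI, hp0, hp⟩ := ord_exists hI0 hIhom
  obtain ⟨q, hqJ, hq0, hq⟩ := ord_exists hJ0 hJhom
  obtain ⟨r, hrI, hr0, hr⟩ := ord_exists hIJ0 hIJhom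
  obtain ⟨v, hvp, hvq, hvr⟩ := exists_good p q r hp hq hr hp0 hq0 hr0
  have gI : Good I v := ⟨p, hpI, hp, hvp⟩
  have gJ : Good J v := ⟨q, hqJ, hq, hvq⟩
  have gIJ : Good (I ⊓ J) v := ⟨r, hrI, hr, hvr⟩
  have cI := full_good hIhom hIfull gI
  have cJ := full_good hJhom hJfull gJ
  refine ⟨lform v, lform_ne v, lform_hom v, cI, cJ, ordDeg (I ⊓ J) - max (ordDeg I) (ordDeg J), ?_⟩
  have hle : max (ordDeg I) (ordDeg J) ≤ ordDeg (I ⊓ J) :=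
    max_le (ord_le hrI.1 hr0 hr) (ord_le hrI.2 hr0 hr)
  refine ⟨?_, by omega⟩
  have h := snake I J (lform v) (Submodule.colon (I + J) (Ideal.span {lform v}))
    (Submodule.colon I (maxIdeal k)) (Submodule.colon J (maxIdeal k))
    (mem_colon_z _ _) (by rw [← cI]; exact mem_colon_z _ _) (by rw [← cJ]; exact mem_colon_z _ _)
    (Mid v (max (ordDeg I) (ordDeg J))) (Mid v (ordDeg (I ⊓ J)))
    (by rw [sup_eq_Mid hIhom gI, sup_eq_Mid hJhom gJ, Mid_inf]) (sup_eq_Mid hIJhom gIJ).symm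
  rw [length_Mid, length_Mid] at h
  rw [modLength_eq]
  have h2 : ((ordDeg (I ⊓ J) - max (ordDeg I) (ordDeg J) : ℕ) : ℕ∞) +
      (max (ordDeg I) (ordDeg J) : ℕ) = (ordDeg (I ⊓ J) : ℕ) := by
    rw [← Nat.cast_add, Nat.sub_add_cancel hle]
  exact (ENat.add_left_injective_of_ne_top (ENat.natCast_ne_top _)) (h.trans h2.symm)

end
end

section
/- Let k be an infinite field and R = k[x,y] with homogeneous maximal ideal 𝔪 = (x,y). Let I be a nonzero proper homogeneous full ideal of R and let f be a nonzero homogeneous element of degree d with d ≥ o(I) and μ(I + (f)) = μ(I) + 1. Then I + (f) is full if and only if the colon ideal (I : f) contains a linear form. -/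
open MvPolynomial

noncomputable section

variable {k : Type*} [Field k]

/-- The minimal number of generators of an ideal. -/
def mu (I : Ideal (MvPolynomial (Fin 2) k)) : ℕ :=
  sInf {n : ℕ | ∃ s : Finset (MvPolynomial (Fin 2) k), s.card = n ∧
    Ideal.span (s : Set (MvPolynomial (Fin 2) k)) = I}

theorem homComp_mul (b f : MvPolynomial (Fin 2) k) (d n : ℕ) (hf : f.IsHomogeneous d) :
    homogeneousComponent n (b * f) =
      if d ≤ n then homogeneousComponent (n - d) b * f else 0 := by
  have key : ∀ i : ℕ, ∀ c : MvPolynomial (Fin 2) k, c.IsHomogeneous i →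
      homogeneousComponent n (c * f) =
        if d ≤ n then homogeneousComponent (n - d) c * f else 0 := by
    intro i c hc
    rw [homogeneousComponent_of_mem (hc.mul hf), homogeneousComponent_of_mem hc]
    split_ifs <;> first | rfl | (exfalso; omega)
  conv_lhs => rw [← sum_homogeneousComponent b]
  rw [Finset.sum_mul, map_sum]
  rw [Finset.sum_congr rfl (fun i _ => key i _ (homogeneousComponent_isHomogeneous i b))]
  split_ifs
  · rw [← Finset.sum_mul, ← map_sum, sum_homogeneousComponent]
  · simp

theorem homComp_linear_mul (z a : MvPolynomial (Fin 2) k) (n : ℕ) (hz : z.IsHomogeneous 1) :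
    homogeneousComponent (n + 1) (z * a) = z * homogeneousComponent n a := by
  rw [mul_comm, homComp_mul a z 1 (n + 1) hz]
  simp [mul_comm]

theorem hom_cancel (z a : MvPolynomial (Fin 2) k) (n : ℕ) (hz : z.IsHomogeneous 1)
    (hz0 : z ≠ 0) (h : (z * a).IsHomogeneous (n + 1)) : a.IsHomogeneous n := by
  have h1 := homogeneousComponent_eq_self h
  rw [homComp_linear_mul z a n hz] at h1
  rw [← mul_left_cancel₀ hz0 h1]
  exact homogeneousComponent_isHomogeneous n a

theorem mem_of_comps (I : Ideal (MvPolynomial (Fin 2) k)) (p : MvPolynomial (Fin 2) k)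
    (h : ∀ n, homogeneousComponent n p ∈ I) : p ∈ I := by
  rw [← sum_homogeneousComponent p]
  exact Ideal.sum_mem _ fun i _ => h i

theorem linear_form (z : MvPolynomial (Fin 2) k) (hz : z.IsHomogeneous 1) :
    ∃ a b : k, z = C a * X 0 + C b * X 1 := by
  have h : z ∈ homogeneousSubmodule (Fin 2) k 1 := hz
  rw [homogeneousSubmodule_one_eq_span_X] at h
  obtain ⟨c, hc⟩ := (Submodule.mem_span_range_iff_exists_fun k).1 h
  refine ⟨c 0, c 1, ?_⟩
  rw [← hc, Fin.sum_univ_two, smul_eq_C_mul, smul_eq_C_mul]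

/-- A pair of independent linear forms with the point where `z = 0` and `w = 1`. -/
structure Frame (z w : MvPolynomial (Fin 2) k) (v : Fin 2 → k) : Prop where
  hz : z.IsHomogeneous 1
  hw : w.IsHomogeneous 1
  ez : eval v z = 0
  ew : eval v w = 1
  z0 : z ≠ 0
  hX : ∀ i, ∃ c : k, (X i : MvPolynomial (Fin 2) k) = C (v i) * w + C c * z

theorem frame_mk (z w : MvPolynomial (Fin 2) k) (hz : z.IsHomogeneous 1) (hz0 : z ≠ 0)
    (hw : w.IsHomogeneous 1) (v : Fin 2 → k) (ez : eval v z = 0) (ew : eval v w = 1) :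
    Frame z w v := by
  obtain ⟨a, b, rfl⟩ := linear_form z hz
  obtain ⟨c, e, rfl⟩ := linear_form w hw
  simp only [map_add, map_mul, eval_C, eval_X] at ez ew
  have hdet : a * e - b * c ≠ 0 := by
    intro h
    have h1 : a = 0 := by linear_combination v 1 * h + (- a) * ew + c * ez
    have h2 : b = 0 := by linear_combination (- v 0) * h + (- b) * ew + e * ez
    apply hz0
    simp [h1, h2]
  have hv0 : v 0 = -b / (a * e - b * c) := by
    rw [eq_div_iff hdet]; linear_combination e * ez - b * ew
  have hv1 : v 1 = a / (a * e - b * c) := by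
    rw [eq_div_iff hdet]; linear_combination a * ew - c * ez
  refine ⟨hz, hw, by simpa using ez, by simpa using ew, hz0, ?_⟩
  have hC : (C (a * e - b * c) : MvPolynomial (Fin 2) k) * C (a * e - b * c)⁻¹ = 1 := by
    rw [← C_mul, mul_inv_cancel₀ hdet, C_1]
  intro i
  fin_cases i
  · refine ⟨e / (a * e - b * c), ?_⟩
    change X 0 = C (v 0) * _ + _
    rw [hv0]
    simp only [div_eq_mul_inv, C_mul, C_sub, C_neg] at hC ⊢
    linear_combination (- X 0) * hC
  · refine ⟨-c / (a * e - b * c), ?_⟩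
    change X 1 = C (v 1) * _ + _
    rw [hv1]
    simp only [div_eq_mul_inv, C_mul, C_sub, C_neg] at hC ⊢
    linear_combination (- X 1) * hC

theorem frame_exists (z : MvPolynomial (Fin 2) k) (hz : z.IsHomogeneous 1) (hz0 : z ≠ 0) :
    ∃ w v, Frame z w v := by
  obtain ⟨a, b, h⟩ := linear_form z hz
  by_cases hb : b = 0
  · have ha : a ≠ 0 := by
      rintro rfl
      simp [hb] at h
      exact hz0 h
    refine ⟨X 1, ![0, 1], frame_mk _ _ hz hz0 (isHomogeneous_X _ _) _ ?_ ?_⟩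
    · simp [h, hb]
    · simp
  · refine ⟨X 0, ![1, - a / b], frame_mk _ _ hz hz0 (isHomogeneous_X _ _) _ ?_ ?_⟩
    · simp [h]; field_simp; ring
    · simp

theorem Frame.sub_dvd {z w : MvPolynomial (Fin 2) k} {v : Fin 2 → k} (F : Frame z w v)
    (p : MvPolynomial (Fin 2) k) (n : ℕ) (hp : p.IsHomogeneous n) :
    z ∣ p - C (eval v p) * w ^ n := by
  rw [← Ideal.mem_span_singleton]
  rw [← Ideal.Quotient.mk_eq_mk_iff_sub_mem]
  set π := Ideal.Quotient.mk (Ideal.span {z})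
  have hzz : π z = 0 := Ideal.Quotient.eq_zero_iff_mem.2 (Ideal.mem_span_singleton_self z)
  have hx : ∀ i, π (X i) = π (C (v i)) * π w := by
    intro i
    obtain ⟨c, hc⟩ := F.hX i
    conv_lhs => rw [hc]
    simp [hzz]
  conv_lhs => rw [p.as_sum]
  rw [eval_eq, map_sum, map_mul, map_sum, map_sum, Finset.sum_mul]
  refine Finset.sum_congr rfl fun s hs => ?_
  have hdeg : n = s 0 + s 1 := by
    have := hp.degree_eq_sum_deg_support hs
    rw [this, ← Fin.sum_univ_two (f := fun i => s i)]
    apply Finset.sum_subset (Finset.subset_univ _)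
    intro i _ hi
    simpa using hi
  rw [monomial_eq, Finsupp.prod_fintype _ _ (by simp)]
  have : ∏ i ∈ s.support, v i ^ s i = v 0 ^ s 0 * v 1 ^ s 1 := by
    rw [← Fin.prod_univ_two (f := fun i => v i ^ s i)]
    apply Finset.prod_subset (Finset.subset_univ _)
    intro i _ hi
    simp [Finsupp.notMem_support_iff.1 hi]
  rw [this, Fin.prod_univ_two]
  simp only [map_mul, map_pow, hx, hdeg]
  ring

theorem Frame.dvd_iff {z w : MvPolynomial (Fin 2) k} {v : Fin 2 → k} (F : Frame z w v)
    (p : MvPolynomial (Fin 2) k) (n : ℕ) (hp : p.IsHomogeneous n) :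
    z ∣ p ↔ eval v p = 0 := by
  constructor
  · rintro ⟨q, rfl⟩
    simp [F.ez]
  · intro h
    simpa [h] using F.sub_dvd p n hp

theorem prime_linear (z : MvPolynomial (Fin 2) k) (hz : z.IsHomogeneous 1) (hz0 : z ≠ 0) :
    Prime z := by
  rw [← irreducible_iff_prime]
  apply irreducible_of_totalDegree_eq_one (hz.totalDegree hz0)
  intro x hx
  rw [isUnit_iff_ne_zero]
  rintro rfl
  apply hz0
  ext i
  simpa using hx i

/-- `I` is full with respect to the linear form `z`. -/
def FullAt (I : Ideal (MvPolynomial (Fin 2) k)) (z : MvPolynomial (Fin 2) k) : Prop :=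
  ∀ a, z * a ∈ I → ∀ i, X i * a ∈ I

theorem linear_mul_mem (I : Ideal (MvPolynomial (Fin 2) k)) (a w : MvPolynomial (Fin 2) k)
    (hw : w.IsHomogeneous 1) (h : ∀ i, X i * a ∈ I) : w * a ∈ I := by
  obtain ⟨b, c, rfl⟩ := linear_form w hw
  have := I.add_mem (I.mul_mem_left (C b) (h 0)) (I.mul_mem_left (C c) (h 1))
  convert this using 1
  ring

theorem Frame.fullAt {z w : MvPolynomial (Fin 2) k} {v : Fin 2 → k} (F : Frame z w v)
    (I : Ideal (MvPolynomial (Fin 2) k)) (h : ∀ a, z * a ∈ I → w * a ∈ I) : FullAt I z := by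
  intro a ha i
  obtain ⟨c, hc⟩ := F.hX i
  rw [hc]
  have := I.add_mem (I.mul_mem_left (C (v i)) (h a ha)) (I.mul_mem_left (C c) ha)
  convert this using 1
  ring

theorem isFull_iff (I : Ideal (MvPolynomial (Fin 2) k)) :
    IsFull I ↔ ∃ z : MvPolynomial (Fin 2) k, z ≠ 0 ∧ z.IsHomogeneous 1 ∧ FullAt I z := by
  have hm : ∀ a, a ∈ Submodule.colon I (maxIdeal k : Set (MvPolynomial (Fin 2) k)) ↔
      ∀ i, X i * a ∈ I := by
    intro a
    rw [maxIdeal, Ideal.span, Submodule.colon_span, Submodule.mem_colon]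
    simp [Fin.forall_fin_two, mul_comm]
  refine exists_congr fun z => and_congr_right fun hz0 => and_congr_right fun hz => ?_
  constructor
  · intro h a ha
    rw [← hm, ← h, Ideal.mem_colon_span_singleton, mul_comm]
    exact ha
  · intro h
    ext a
    rw [hm, Ideal.mem_colon_span_singleton, mul_comm]
    exact ⟨h a, fun h' => linear_mul_mem I a z hz h'⟩

theorem exists_not_dvd (I : Ideal (MvPolynomial (Fin 2) k)) (z : MvPolynomial (Fin 2) k)
    (hz : z.IsHomogeneous 1) (hz0 : z ≠ 0) (hfull : FullAt I z) (e : ℕ)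
    (p : MvPolynomial (Fin 2) k) (hpI : p ∈ I) (hp0 : p ≠ 0) (hp : p.IsHomogeneous e) :
    ∃ g ∈ I, g.IsHomogeneous e ∧ ¬ z ∣ g := by
  by_contra hcon
  push Not at hcon
  obtain ⟨w, v, F⟩ := frame_exists z hz hz0
  have hpr := prime_linear z hz hz0
  have hzw : ¬ z ∣ w := by
    rw [F.dvd_iff w 1 F.hw, F.ew]; exact one_ne_zero
  have key : ∀ n : ℕ, ∀ p ∈ I, p.IsHomogeneous e → z ^ n ∣ p := by
    intro n
    induction n with
    | zero => intro p _ _; simp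
    | succ n ih =>
      intro p hpI hp
      obtain ⟨q, rfl⟩ := hcon p hpI hp
      have hwq : w * q ∈ I := linear_mul_mem I q w F.hw (hfull q hpI)
      have hwq' : (w * q).IsHomogeneous e := by
        apply hom_cancel z _ _ hz hz0
        have := F.hw.mul hp
        convert this using 1
        · ring
        · ring
      have := hpr.pow_dvd_of_dvd_mul_left n hzw (ih _ hwq hwq')
      rw [pow_succ']
      exact mul_dvd_mul_left z this
  obtain ⟨n, hn⟩ := FiniteMultiplicity.of_prime_left hpr hp0
  exact hn (key _ p hpI hp)

theorem full_generic (I : Ideal (MvPolynomial (Fin 2) k)) (hI : IsHomogeneousIdeal I)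
    (x y g : MvPolynomial (Fin 2) k) (hx : x.IsHomogeneous 1) (hx0 : x ≠ 0)
    (hy : y.IsHomogeneous 1) (hy0 : y ≠ 0) (hfull : FullAt I x) (e : ℕ)
    (hmin : ∀ m < e, ∀ p ∈ I, p.IsHomogeneous m → p = 0)
    (hg : g ∈ I) (hge : g.IsHomogeneous e) (hyg : ¬ y ∣ g) : FullAt I y := by
  obtain ⟨w, v, F⟩ := frame_exists x hx hx0
  obtain ⟨u, t, G⟩ := frame_exists y hy hy0
  -- homogeneous version
  have key : ∀ n : ℕ, ∀ a : MvPolynomial (Fin 2) k, a.IsHomogeneous n → y * a ∈ I →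
      x * a ∈ I := by
    intro n a ha hya
    have hya' : (y * a).IsHomogeneous (n + 1) := by
      rw [add_comm]; exact hy.mul ha
    by_cases hn : n + 1 < e
    · have := hmin _ hn _ hya hya'
      rcases mul_eq_zero.1 this with h | h
      · exact absurd h hy0
      · simp [h]
    push Not at hn
    let W : Submodule k (MvPolynomial (Fin 2) k) :=
      homogeneousSubmodule (Fin 2) k (n + 1) ⊓ I.restrictScalars k
    have hmW : ∀ p, p ∈ W ↔ p.IsHomogeneous (n + 1) ∧ p ∈ I := fun p => Iff.rfl
    have : FiniteDimensional k W := by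
      have : FiniteDimensional k (homogeneousSubmodule (Fin 2) k (n + 1)) :=
        Module.Finite.iff_fg.2 (homogeneousSubmodule_fg _ _ _)
      exact Submodule.finiteDimensional_inf_left _ _
    let mx : MvPolynomial (Fin 2) k →ₗ[k] MvPolynomial (Fin 2) k := LinearMap.mulLeft k x
    let my : MvPolynomial (Fin 2) k →ₗ[k] MvPolynomial (Fin 2) k := LinearMap.mulLeft k y
    have mxi : Function.Injective mx := fun p q h => mul_left_cancel₀ hx0 h
    have myi : Function.Injective my := fun p q h => mul_left_cancel₀ hy0 h
    let L : Submodule k (MvPolynomial (Fin 2) k) := W.comap mx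
    have hLx : L.map mx ≤ W := Submodule.map_comap_le _ _
    have hL : ∀ q ∈ L, q.IsHomogeneous n ∧ x * q ∈ I := by
      intro q hq
      exact ⟨hom_cancel x q n hx hx0 hq.1, hq.2⟩
    have hLy : L.map my ≤ W := by
      rintro _ ⟨q, hq, rfl⟩
      refine ⟨?_, ?_⟩
      · rw [add_comm]; exact hy.mul (hL q hq).1
      · exact linear_mul_mem I q y hy (hfull q (hL q hq).2)
    have r1 : Module.finrank k (L.map mx) = Module.finrank k L :=
      (Submodule.equivMapOfInjective mx mxi L).finrank_eq.symm
    let Ly : Submodule k (MvPolynomial (Fin 2) k) := W.comap my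
    have hLyW : Ly.map my ≤ W := Submodule.map_comap_le _ _
    have r2 : Module.finrank k (Ly.map my) = Module.finrank k Ly :=
      (Submodule.equivMapOfInjective my myi Ly).finrank_eq.symm
    have hfLx : FiniteDimensional k (L.map mx) := Submodule.finiteDimensional_of_le hLx
    have hfL : FiniteDimensional k L :=
      (Submodule.equivMapOfInjective mx mxi L).symm.finiteDimensional
    have hfLy' : FiniteDimensional k (Ly.map my) := Submodule.finiteDimensional_of_le hLyW
    have hfLy : FiniteDimensional k Ly :=
      (Submodule.equivMapOfInjective my myi Ly).symm.finiteDimensional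
    have hle : L ≤ Ly := Submodule.map_le_iff_le_comap.1 hLy
    let ev : W →ₗ[k] k := (aeval v : MvPolynomial (Fin 2) k →ₐ[k] k).toLinearMap ∘ₗ W.subtype
    have hker : (LinearMap.ker ev).map W.subtype ≤ L.map mx := by
      rintro _ ⟨⟨p, hp⟩, hpk, rfl⟩
      have hp0 : eval v p = 0 := by
        have : aeval v p = 0 := hpk
        rwa [aeval_eq_eval] at this
      obtain ⟨q, rfl⟩ := (F.dvd_iff p _ hp.1).2 hp0
      exact ⟨q, hp, rfl⟩
    have r3 : Module.finrank k (LinearMap.ker ev) ≤ Module.finrank k L := by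
      rw [← r1, (Submodule.equivMapOfInjective W.subtype W.injective_subtype _).finrank_eq]
      exact Submodule.finrank_mono hker
    have r4 : Module.finrank k (LinearMap.range ev) ≤ 1 := by
      simpa using Submodule.finrank_le (LinearMap.range ev)
    have r5 := LinearMap.finrank_range_add_finrank_ker ev
    have hlt : Ly.map my < W := by
      refine lt_of_le_of_ne hLyW fun heq => ?_
      have hmem : u ^ (n + 1 - e) * g ∈ W := by
        refine ⟨?_, I.mul_mem_left _ hg⟩
        have h1 := (G.hw.pow (n + 1 - e)).mul hge
        have h2 : 1 * (n + 1 - e) + e = n + 1 := by omega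
        rw [h2] at h1
        exact h1
      have hev : eval t (u ^ (n + 1 - e) * g) = 0 := by
        rw [← heq] at hmem
        obtain ⟨q, -, hq⟩ := hmem
        rw [← hq]
        change eval t (y * q) = 0
        simp [G.ez]
      rw [map_mul, map_pow, G.ew, one_pow, one_mul] at hev
      exact hyg ((G.dvd_iff g e hge).2 hev)
    have r6 : Module.finrank k Ly < Module.finrank k W := by
      rw [← r2]; exact Submodule.finrank_lt_finrank_of_lt hlt
    have heq : L = Ly := Submodule.eq_of_le_of_finrank_le hle (by omega)
    have haL : a ∈ L := by
      rw [heq]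
      exact ⟨hya', hya⟩
    exact (hL a haL).2
  have key2 : ∀ a, y * a ∈ I → x * a ∈ I := by
    intro a ha
    rw [← sum_homogeneousComponent a, Finset.mul_sum]
    refine Ideal.sum_mem _ fun n _ => key n _ (homogeneousComponent_isHomogeneous n a) ?_
    rw [← homComp_linear_mul y a n hy]
    exact hI _ ha _
  exact fun a ha => hfull a (key2 a ha)

theorem exists_generic [Infinite k] (g G : MvPolynomial (Fin 2) k) (hg : g ≠ 0) (hG : G ≠ 0) :
    ∃ z : MvPolynomial (Fin 2) k, z ≠ 0 ∧ z.IsHomogeneous 1 ∧ ¬ z ∣ g ∧ ¬ z ∣ G := by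
  have hP : g * G * X 0 ≠ 0 := mul_ne_zero (mul_ne_zero hg hG) (X_ne_zero _)
  obtain ⟨v, hv⟩ : ∃ v : Fin 2 → k, eval v (g * G * X 0) ≠ 0 := by
    by_contra! h
    exact hP (MvPolynomial.funext fun v => by rw [h v, map_zero])
  simp only [map_mul, eval_X, mul_ne_zero_iff] at hv
  have hev : eval v (C (v 1) * X 0 - C (v 0) * X 1) = 0 := by simp; ring
  refine ⟨C (v 1) * X 0 - C (v 0) * X 1, ?_, ?_, ?_, ?_⟩
  · intro h
    have := congrArg (eval ![0, 1]) h
    simp at this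
    exact hv.2 this
  · exact (isHomogeneous_C_mul_X _ _).sub (isHomogeneous_C_mul_X _ _)
  · rintro ⟨q, hq⟩
    apply hv.1.1
    rw [hq, map_mul, hev, zero_mul]
  · rintro ⟨q, hq⟩
    apply hv.1.2
    rw [hq, map_mul, hev, zero_mul]

theorem hom_add_span (I : Ideal (MvPolynomial (Fin 2) k)) (hI : IsHomogeneousIdeal I)
    (f : MvPolynomial (Fin 2) k) (d : ℕ) (hf : f.IsHomogeneous d) :
    IsHomogeneousIdeal (I + Ideal.span {f}) := by
  intro p hp n
  obtain ⟨i, hi, q, hq, rfl⟩ := Submodule.mem_sup.1 hp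
  obtain ⟨b, rfl⟩ := Ideal.mem_span_singleton'.1 hq
  rw [map_add, homComp_mul b f d n hf]
  refine Submodule.add_mem_sup (hI i hi n) ?_
  split_ifs
  · exact Ideal.mul_mem_left _ _ (Ideal.mem_span_singleton_self f)
  · exact Submodule.zero_mem _

theorem mem_max_mul (J : Ideal (MvPolynomial (Fin 2) k)) (p : MvPolynomial (Fin 2) k) :
    p ∈ maxIdeal k * J ↔ ∃ a ∈ J, ∃ b ∈ J, p = X 0 * a + X 1 * b := by
  rw [maxIdeal, Ideal.span_insert, Ideal.sup_mul]
  constructor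
  · intro h
    obtain ⟨s, hs, t, ht, rfl⟩ := Submodule.mem_sup.1 h
    obtain ⟨a, ha, rfl⟩ := Ideal.mem_span_singleton_mul.1 hs
    obtain ⟨b, hb, rfl⟩ := Ideal.mem_span_singleton_mul.1 ht
    exact ⟨a, ha, b, hb, rfl⟩
  · rintro ⟨a, ha, b, hb, rfl⟩
    exact Submodule.add_mem_sup (Ideal.mem_span_singleton_mul.2 ⟨a, ha, rfl⟩)
      (Ideal.mem_span_singleton_mul.2 ⟨b, hb, rfl⟩)

theorem sub_const_mem_max (a : MvPolynomial (Fin 2) k) :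
    a - C (coeff 0 a) ∈ maxIdeal k := by
  apply mem_of_comps
  intro n
  rcases n with _ | n
  · simp
  · have h1 : (homogeneousComponent (n + 1)) (C (coeff 0 a) : MvPolynomial (Fin 2) k) = 0 := by
      rw [homogeneousComponent_of_mem (isHomogeneous_C (Fin 2) (coeff 0 a))]
      simp
    rw [map_sub, h1, sub_zero]
    generalize hq : homogeneousComponent (n + 1) a = q
    have hqh : q.IsHomogeneous (n + 1) := hq ▸ homogeneousComponent_isHomogeneous _ _
    have hx0 : X 0 ∈ maxIdeal k := Ideal.subset_span (by simp)
    have hx1 : X 1 ∈ maxIdeal k := Ideal.subset_span (by simp)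
    obtain ⟨w, v, F⟩ := frame_exists (X 0 : MvPolynomial (Fin 2) k)
      (isHomogeneous_X _ _) (X_ne_zero _)
    obtain ⟨r, hr⟩ := F.sub_dvd q _ hqh
    have hw : w ∈ maxIdeal k := by
      obtain ⟨b, c, rfl⟩ := linear_form w F.hw
      exact Ideal.add_mem _ (Ideal.mul_mem_left _ _ hx0) (Ideal.mul_mem_left _ _ hx1)
    have : q = X 0 * r + C (eval v q) * w ^ n * w := by
      rw [← hr]; ring
    rw [this]
    exact Ideal.add_mem _ (Ideal.mul_mem_right _ _ hx0) (Ideal.mul_mem_left _ _ hw)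

/-- Graded Nakayama. -/
theorem nakayama (J N : Ideal (MvPolynomial (Fin 2) k))
    (hN : IsHomogeneousIdeal N) (h : J ≤ N + maxIdeal k * J) : J ≤ N := by
  have key : ∀ n, ∀ p ∈ J, homogeneousComponent n p ∈ N := by
    intro n
    induction n with
    | zero =>
      intro p hp
      obtain ⟨t, ht, q, hq, rfl⟩ := Submodule.mem_sup.1 (h hp)
      obtain ⟨a, ha, b, hb, rfl⟩ := (mem_max_mul J q).1 hq
      have := hN t ht 0
      rw [map_add]
      refine N.add_mem this ?_
      rw [mul_comm, mul_comm (X 1), map_add, homComp_mul _ _ 1 _ (isHomogeneous_X _ _),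
        homComp_mul _ _ 1 _ (isHomogeneous_X _ _)]
      simp
    | succ n ih =>
      intro p hp
      obtain ⟨t, ht, q, hq, rfl⟩ := Submodule.mem_sup.1 (h hp)
      obtain ⟨a, ha, b, hb, rfl⟩ := (mem_max_mul J q).1 hq
      rw [map_add, map_add, homComp_linear_mul _ _ _ (isHomogeneous_X _ _),
        homComp_linear_mul _ _ _ (isHomogeneous_X _ _)]
      exact N.add_mem (hN t ht _) (N.add_mem (N.mul_mem_left _ (ih a ha))
        (N.mul_mem_left _ (ih b hb)))
  exact fun p hp => mem_of_comps N p fun n => key n p hp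

theorem hom_span (s : Set (MvPolynomial (Fin 2) k))
    (hs : ∀ p ∈ s, ∃ n, p.IsHomogeneous n) : IsHomogeneousIdeal (Ideal.span s) := by
  intro p hp n
  induction hp using Submodule.span_induction generalizing n with
  | mem x hx =>
    obtain ⟨m, hm⟩ := hs x hx
    rw [homogeneousComponent_of_mem hm]
    split_ifs
    · exact Ideal.subset_span hx
    · exact Submodule.zero_mem _
  | zero => simp
  | add x y _ _ hx hy => rw [map_add]; exact Ideal.add_mem _ (hx n) (hy n)
  | smul a x _ hx =>
    rw [smul_eq_mul]
    conv => rw [← sum_homogeneousComponent x, Finset.mul_sum, map_sum]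
    refine Ideal.sum_mem _ fun i _ => ?_
    rw [homComp_mul _ _ i _ (homogeneousComponent_isHomogeneous _ _)]
    split_ifs
    · exact Ideal.mul_mem_left _ _ (hx i)
    · exact Submodule.zero_mem _

theorem mu_le (J : Ideal (MvPolynomial (Fin 2) k)) (hJ : IsHomogeneousIdeal J)
    (T : Finset (MvPolynomial (Fin 2) k))
    (hT : J ≤ Ideal.span (T : Set (MvPolynomial (Fin 2) k)) + maxIdeal k * J)
    (hTJ : (T : Set (MvPolynomial (Fin 2) k)) ⊆ J) :
    mu J ≤ T.card := by
  classical
  let Q : MvPolynomial (Fin 2) k →ₗ[k] (MvPolynomial (Fin 2) k ⧸ (maxIdeal k * J)) :=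
    (Ideal.Quotient.mkₐ k (maxIdeal k * J)).toLinearMap
  have hQ : ∀ p q, Q p = Q q ↔ p - q ∈ maxIdeal k * J := fun p q =>
    Ideal.Quotient.mk_eq_mk_iff_sub_mem p q
  have hQ0 : ∀ p, Q p = 0 ↔ p ∈ maxIdeal k * J := fun p =>
    Ideal.Quotient.eq_zero_iff_mem
  let H : Set (MvPolynomial (Fin 2) k) := {p | p ∈ J ∧ ∃ n, p.IsHomogeneous n}
  have hsm : ∀ a, ∀ t ∈ J, Q (a * t) = coeff 0 a • Q t := by
    intro a t ht
    rw [← map_smul, hQ, smul_eq_C_mul, ← sub_mul]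
    exact Ideal.mul_mem_mul (sub_const_mem_max a) ht
  have hspan : ∀ p ∈ J, Q p ∈ Submodule.span k ((T.image Q : Finset _) : Set _) := by
    intro p hp
    obtain ⟨t, ht, q, hq, rfl⟩ := Submodule.mem_sup.1 (hT hp)
    rw [map_add, (hQ0 q).2 hq, add_zero]
    obtain ⟨c, -, rfl⟩ := Submodule.mem_span_finset.1 ht
    rw [map_sum]
    refine Submodule.sum_mem _ fun i hi => ?_
    rw [smul_eq_mul, hsm _ _ (hTJ hi)]
    exact Submodule.smul_mem _ _ (Submodule.subset_span (by
      rw [Finset.mem_coe]; exact Finset.mem_image_of_mem _ hi))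
  obtain ⟨b, hbH, hbspan, hbli⟩ := exists_linearIndependent k (Q '' H)
  have hsub : Set.range ((↑) : b → MvPolynomial (Fin 2) k ⧸ (maxIdeal k * J)) ≤
      ((Submodule.span k ((T.image Q : Finset (MvPolynomial (Fin 2) k ⧸ (maxIdeal k * J))) :
        Set (MvPolynomial (Fin 2) k ⧸ (maxIdeal k * J))) :
        Submodule k (MvPolynomial (Fin 2) k ⧸ (maxIdeal k * J))) :
        Set (MvPolynomial (Fin 2) k ⧸ (maxIdeal k * J))) := by
    rintro _ ⟨⟨x, hx⟩, rfl⟩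
    obtain ⟨p, hp, rfl⟩ := hbH hx
    exact hspan p hp.1
  have hcard := linearIndependent_le_span' _ hbli _ hsub
  have hbfin : b.Finite := by
    rw [← Set.finite_coe_iff, ← Cardinal.lt_aleph0_iff_finite]
    exact lt_of_le_of_lt hcard Cardinal.natCast_lt_aleph0
  have : Fintype b := hbfin.fintype
  rw [Cardinal.mk_fintype, Nat.cast_le] at hcard
  have hcard2 : Fintype.card b ≤ T.card := by
    refine hcard.trans ?_
    simpa using (Finset.card_image_le (s := T) (f := Q))
  choose p hpH hpQ using fun x : b => hbH x.2
  let s : Finset (MvPolynomial (Fin 2) k) := Finset.univ.image p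
  have hs : s.card ≤ T.card := Finset.card_image_le.trans hcard2
  have hsp : ∀ q ∈ s, q ∈ H := by
    intro q hq
    obtain ⟨x, -, rfl⟩ := Finset.mem_image.1 hq
    exact hpH x
  have hsJ : Ideal.span (s : Set (MvPolynomial (Fin 2) k)) = J := by
    apply le_antisymm
    · exact Ideal.span_le.2 fun q hq => (hsp q hq).1
    · apply nakayama J _ (hom_span _ fun q hq => (hsp q hq).2)
      have hbs : Submodule.span k b ≤
          (Submodule.span k (s : Set (MvPolynomial (Fin 2) k))).map Q := by
        rw [Submodule.span_le]
        intro x hx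
        refine ⟨p ⟨x, hx⟩, Submodule.subset_span ?_, hpQ ⟨x, hx⟩⟩
        exact Finset.mem_coe.2 (Finset.mem_image_of_mem _ (Finset.mem_univ _))
      intro q hq
      have hqb : Q q ∈ Submodule.span k b := by
        rw [hbspan, ← sum_homogeneousComponent q, map_sum]
        exact Submodule.sum_mem _ fun i _ => Submodule.subset_span
          ⟨_, ⟨hJ q hq i, i, homogeneousComponent_isHomogeneous _ _⟩, rfl⟩
      obtain ⟨r, hr, hrq⟩ := hbs hqb
      have hr' : r ∈ Ideal.span (s : Set (MvPolynomial (Fin 2) k)) :=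
        Submodule.span_le_restrictScalars k (MvPolynomial (Fin 2) k) _ hr
      have h2 := (hQ q r).1 hrq.symm
      rw [← add_sub_cancel r q]
      exact Submodule.add_mem_sup hr' h2
  exact le_trans (Nat.sInf_le ⟨s, rfl, hsJ⟩) hs

theorem mem_max_mul_of_mu (I : Ideal (MvPolynomial (Fin 2) k)) (hI : IsHomogeneousIdeal I)
    (f w : MvPolynomial (Fin 2) k) (d : ℕ) (hf : f.IsHomogeneous d)
    (hw : w.IsHomogeneous 1)
    (hmu : mu (I + Ideal.span {f}) = mu I + 1) (hwf : w * f ∈ I) :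
    w * f ∈ maxIdeal k * I := by
  classical
  by_contra hcon
  set J := I + Ideal.span {f} with hJdef
  have hIJ : I ≤ J := le_sup_left
  have hfJ : f ∈ J := (le_sup_right : Ideal.span {f} ≤ J) (Ideal.mem_span_singleton_self f)
  have hJ : IsHomogeneousIdeal J := hom_add_span I hI f d hf
  have hne : {n : ℕ | ∃ s : Finset (MvPolynomial (Fin 2) k), s.card = n ∧
      Ideal.span (s : Set (MvPolynomial (Fin 2) k)) = I}.Nonempty := by
    obtain ⟨s, hs⟩ := (isNoetherianRing_iff_ideal_fg _).1
      (inferInstance : IsNoetherianRing (MvPolynomial (Fin 2) k)) I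
    exact ⟨_, s, rfl, hs⟩
  obtain ⟨s, hsc, hsI⟩ := Nat.sInf_mem hne
  change s.card = mu I at hsc
  have hsI' : ∀ q ∈ s, q ∈ I := fun q hq => hsI ▸ Ideal.subset_span hq
  have hwf' := hwf
  rw [← hsI] at hwf'
  obtain ⟨c, -, hc⟩ := Submodule.mem_span_finset.1 hwf'
  have hex : ∃ q ∈ s, coeff 0 (c q) ≠ 0 := by
    by_contra! hall
    apply hcon
    rw [← hc]
    refine Ideal.sum_mem _ fun q hq => ?_
    have := sub_const_mem_max (c q)
    rw [hall q hq, C_0, sub_zero] at this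
    exact Ideal.mul_mem_mul this (hsI' q hq)
  obtain ⟨q0, hq0, hcq0⟩ := hex
  have hmax : ∀ i : Fin 2, X i ∈ maxIdeal k := by
    intro i
    fin_cases i <;> exact Ideal.subset_span (by simp)
  have hwm : w ∈ maxIdeal k := by
    have := linear_mul_mem (maxIdeal k) 1 w hw (fun i => by simpa using hmax i)
    simpa using this
  let T := insert f (s.erase q0)
  have hTc : T.card ≤ mu I := by
    refine (Finset.card_insert_le _ _).trans ?_
    rw [Finset.card_erase_add_one hq0, hsc]
  have hTJ : (T : Set (MvPolynomial (Fin 2) k)) ⊆ J := by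
    intro q hq
    rcases Finset.mem_insert.1 hq with rfl | hq
    · exact hfJ
    · exact hIJ (hsI' q (Finset.mem_of_mem_erase hq))
  have hTs : Ideal.span (T : Set (MvPolynomial (Fin 2) k)) ≤
      Ideal.span (T : Set (MvPolynomial (Fin 2) k)) + maxIdeal k * J := le_sup_left
  have hmJ : maxIdeal k * J ≤
      Ideal.span (T : Set (MvPolynomial (Fin 2) k)) + maxIdeal k * J := le_sup_right
  have hJT : J ≤ Ideal.span (T : Set (MvPolynomial (Fin 2) k)) + maxIdeal k * J := by
    apply sup_le
    · rw [← hsI, Ideal.span_le]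
      intro q hq
      by_cases hqq : q = q0
      · subst hqq
        rw [← Finset.add_sum_erase _ _ hq0] at hc
        have h1 : C (coeff 0 (c q)) * q = w * f -
            ∑ x ∈ s.erase q, c x • x - (c q - C (coeff 0 (c q))) * q := by
          rw [← hc, smul_eq_mul]; ring
        have h2 : C (coeff 0 (c q)) * q ∈
            Ideal.span (T : Set (MvPolynomial (Fin 2) k)) + maxIdeal k * J := by
          rw [h1]
          refine Ideal.sub_mem _ (Ideal.sub_mem _ ?_ ?_) ?_
          · exact hmJ (Ideal.mul_mem_mul hwm hfJ)
          · refine hTs (Ideal.sum_mem _ fun x hx => ?_)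
            exact Ideal.mul_mem_left _ _ (Ideal.subset_span
              (Finset.mem_coe.2 (Finset.mem_insert_of_mem hx)))
          · exact hmJ (Ideal.mul_mem_mul (sub_const_mem_max _) (hIJ (hsI' q hq)))
        have h3 := Ideal.mul_mem_left _ (C (coeff 0 (c q))⁻¹) h2
        rwa [← mul_assoc, ← C_mul, inv_mul_cancel₀ hcq0, C_1, one_mul] at h3
      · exact hTs (Ideal.subset_span (Finset.mem_coe.2
          (Finset.mem_insert_of_mem (Finset.mem_erase.2 ⟨hqq, hq⟩))))
    · rw [Ideal.span_le]
      rintro _ rfl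
      exact hTs (Ideal.subset_span (Finset.mem_coe.2 (Finset.mem_insert_self _ _)))
  have := mu_le J hJ T hJT hTJ
  omega

theorem exists_ord (I : Ideal (MvPolynomial (Fin 2) k)) (hI0 : I ≠ ⊥)
    (hI : IsHomogeneousIdeal I) :
    (∃ p ∈ I, p ≠ 0 ∧ p.IsHomogeneous (ordDeg I)) ∧
      ∀ m < ordDeg I, ∀ p ∈ I, p.IsHomogeneous m → p = 0 := by
  constructor
  · apply Nat.sInf_mem (s := {d : ℕ | ∃ p ∈ I, p ≠ 0 ∧ MvPolynomial.IsHomogeneous p d})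
    obtain ⟨p, hp, hp0⟩ := Submodule.exists_mem_ne_zero_of_ne_bot hI0
    by_contra hne
    apply hp0
    rw [← sum_homogeneousComponent p]
    refine Finset.sum_eq_zero fun i _ => ?_
    by_contra hi
    exact hne ⟨i, _, hI p hp i, hi, homogeneousComponent_isHomogeneous _ _⟩
  · intro m hm p hp hpm
    by_contra h
    exact Nat.notMem_of_lt_sInf hm ⟨p, hp, h, hpm⟩

/-- Subtracting a multiple of `g` makes `p` divisible by `z`. -/
theorem Frame.reduce {z w : MvPolynomial (Fin 2) k} {v : Fin 2 → k} (F : Frame z w v)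
    (g p : MvPolynomial (Fin 2) k) (e d : ℕ) (hed : e ≤ d) (hg : g.IsHomogeneous e)
    (hzg : ¬ z ∣ g) (hp : p.IsHomogeneous d) :
    ∃ c : k, ∃ h, p = C c * w ^ (d - e) * g + z * h ∧ (z * h).IsHomogeneous d := by
  have hg0 : eval v g ≠ 0 := fun h => hzg ((F.dvd_iff g e hg).2 h)
  have hh : (C (eval v p / eval v g) * w ^ (d - e) * g).IsHomogeneous d := by
    have := ((F.hw.pow (d - e)).C_mul (eval v p / eval v g)).mul hg
    convert this using 1
    omega
  have hh2 := hp.sub hh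
  obtain ⟨h, hh3⟩ := (F.dvd_iff _ d hh2).2 (by
    simp [F.ew, div_mul_cancel₀ _ hg0])
  refine ⟨eval v p / eval v g, h, ?_, ?_⟩
  · rw [← hh3]; ring
  · rw [← hh3]; exact hh2

theorem main_forward [Infinite k]
    (I : Ideal (MvPolynomial (Fin 2) k)) (hI0 : I ≠ ⊥)
    (hI : IsHomogeneousIdeal I) (hIfull : IsFull I)
    (f : MvPolynomial (Fin 2) k) (d : ℕ) (hf : f.IsHomogeneous d)
    (hd : ordDeg I ≤ d) (hJfull : IsFull (I + Ideal.span {f})) :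
    ∃ z : MvPolynomial (Fin 2) k, z ≠ 0 ∧ z.IsHomogeneous 1 ∧ z * f ∈ I := by
  set J := I + Ideal.span {f} with hJdef
  have hIJ : I ≤ J := le_sup_left
  have hfJ : f ∈ J := (le_sup_right : Ideal.span {f} ≤ J) (Ideal.mem_span_singleton_self f)
  have hJ : IsHomogeneousIdeal J := hom_add_span I hI f d hf
  have hJ0 : J ≠ ⊥ := fun h => hI0 (le_bot_iff.1 (h ▸ hIJ))
  obtain ⟨x, hx0, hx, hIx⟩ := (isFull_iff I).1 hIfull
  obtain ⟨y, hy0, hy, hJy⟩ := (isFull_iff J).1 hJfull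
  obtain ⟨⟨p, hpI, hp0, hp⟩, hmin⟩ := exists_ord I hI0 hI
  obtain ⟨⟨p', hpJ, hp0', hp'⟩, hmin'⟩ := exists_ord J hJ0 hJ
  obtain ⟨z, hz0, hz, hzg, hzG⟩ := exists_generic p p' hp0 hp0'
  have hIz := full_generic I hI x z p hx hx0 hz hz0 hIx _ hmin hpI hp hzg
  have hJz := full_generic J hJ y z p' hy hy0 hz hz0 hJy _ hmin' hpJ hp' hzG
  obtain ⟨w, v, F⟩ := frame_exists z hz hz0
  obtain ⟨c, h, hfh, hzh⟩ := F.reduce p f _ _ hd hp hzg hf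
  have hpI' : C c * w ^ (d - ordDeg I) * p ∈ I := I.mul_mem_left _ hpI
  have hzhJ : z * h ∈ J := by
    have : z * h = f - C c * w ^ (d - ordDeg I) * p := by rw [hfh]; ring
    rw [this]
    exact J.sub_mem hfJ (hIJ hpI')
  have hwh : w * h ∈ J := linear_mul_mem J h w F.hw (hJz h hzhJ)
  have hwhd : (w * h).IsHomogeneous d := by
    apply hom_cancel z _ _ hz hz0
    have := F.hw.mul hzh
    convert this using 1
    · ring
    · ring
  obtain ⟨i, hi, q, hq, hiq⟩ := Submodule.mem_sup.1 hwh
  obtain ⟨b, rfl⟩ := Ideal.mem_span_singleton'.1 hq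
  have h1 := congrArg (homogeneousComponent d) hiq
  rw [map_add, homComp_mul b f d d hf, homogeneousComponent_eq_self hwhd, if_pos le_rfl,
    Nat.sub_self, homogeneousComponent_zero] at h1
  generalize coeff 0 b = β at h1
  have hid : homogeneousComponent d i ∈ I := hI i hi d
  refine ⟨w - C β * z, ?_, F.hw.sub (hz.C_mul β), ?_⟩
  · intro h0
    have := congrArg (eval v) h0
    simp [F.ew, F.ez] at this
  · have e1 : (w - C β * z) * f = z * (homogeneousComponent d i) + w * (C c * w ^ (d - ordDeg I) * p) := by
      linear_combination (w + 0) * hfh - z * h1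
    rw [e1]
    exact I.add_mem (I.mul_mem_left _ hid) (I.mul_mem_left _ hpI')

theorem main_backward
    (I : Ideal (MvPolynomial (Fin 2) k)) (hI0 : I ≠ ⊥)
    (hI : IsHomogeneousIdeal I) (hIfull : IsFull I)
    (f : MvPolynomial (Fin 2) k) (d : ℕ) (hf : f.IsHomogeneous d)
    (hd : ordDeg I ≤ d)
    (hmu : mu (I + Ideal.span {f}) = mu I + 1)
    (hz : ∃ z : MvPolynomial (Fin 2) k, z ≠ 0 ∧ z.IsHomogeneous 1 ∧ z * f ∈ I) :
    IsFull (I + Ideal.span {f}) := by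
  obtain ⟨x, hx0, hx, hIx⟩ := (isFull_iff I).1 hIfull
  obtain ⟨w, v, F, hwf⟩ : ∃ w v, Frame x w v ∧ w * f ∈ I := by
    obtain ⟨z, hz0, hz, hzf⟩ := hz
    obtain ⟨w, v, F⟩ := frame_exists x hx hx0
    by_cases hzv : eval v z = 0
    · obtain ⟨r, hr⟩ := (F.dvd_iff z 1 hz).2 hzv
      have hr0 : r.IsHomogeneous 0 := hom_cancel x r 0 hx hx0 (hr ▸ hz)
      have hrC : r = C (coeff 0 r) := by
        rw [← homogeneousComponent_zero, homogeneousComponent_eq_self hr0]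
      have hne : coeff 0 r ≠ 0 := by
        intro h
        rw [h, C_0] at hrC
        exact hz0 (by rw [hr, hrC, mul_zero])
      refine ⟨w, v, F, linear_mul_mem I f w F.hw (hIx f ?_)⟩
      have h3 := I.mul_mem_left (C (coeff 0 r)⁻¹) hzf
      rw [hr] at h3
      have h4 : C (coeff 0 r)⁻¹ * r = 1 := by
        conv_lhs => rw [hrC]
        rw [coeff_C, if_pos rfl, ← C_mul, inv_mul_cancel₀ hne, C_1]
      have h5 : C (coeff 0 r)⁻¹ * (x * r * f) = x * f := by
        linear_combination (x * f) * h4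
      rwa [h5] at h3
    · refine ⟨C (eval v z)⁻¹ * z, v, frame_mk _ _ hx hx0 (hz.C_mul _) v F.ez ?_, ?_⟩
      · simp [hzv]
      · rw [mul_assoc]; exact I.mul_mem_left _ hzf
  have hmI := mem_max_mul_of_mu I hI f w d hf F.hw hmu hwf
  obtain ⟨⟨p, hpI, hp0, hp⟩, -⟩ := exists_ord I hI0 hI
  obtain ⟨g, hgI, hg, hxg⟩ := exists_not_dvd I x hx hx0 hIx _ p hpI hp0 hp
  obtain ⟨c, h, hfh, hxh⟩ := F.reduce g f _ _ hd hg hxg hf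
  have hgI' : C c * w ^ (d - ordDeg I) * g ∈ I := I.mul_mem_left _ hgI
  have hwh : w * h ∈ I := by
    obtain ⟨a, ha, b, hb, hab⟩ := (mem_max_mul I _).1 hmI
    obtain ⟨c0, hc0⟩ := F.hX 0
    obtain ⟨c1, hc1⟩ := F.hX 1
    -- rewrite the membership in the frame coordinates
    obtain ⟨i, hi, j, hj, hij⟩ : ∃ i ∈ I, ∃ j ∈ I, w * f = x * i + w * j := by
      refine ⟨C c0 * a + C c1 * b, I.add_mem (I.mul_mem_left _ ha) (I.mul_mem_left _ hb),
        C (v 0) * a + C (v 1) * b, I.add_mem (I.mul_mem_left _ ha) (I.mul_mem_left _ hb), ?_⟩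
      rw [hab, hc0, hc1]
      simp only [← hc0, ← hc1]
      linear_combination a * hc0 + b * hc1
    have hij2 := congrArg (homogeneousComponent (d + 1)) hij
    rw [map_add, homComp_linear_mul _ _ _ F.hw, homComp_linear_mul _ _ _ hx,
      homComp_linear_mul _ _ _ F.hw, homogeneousComponent_eq_self hf] at hij2
    have hi' := hI i hi d
    have hj' := hI j hj d
    have hjh : (homogeneousComponent d j).IsHomogeneous d := homogeneousComponent_isHomogeneous _ _
    generalize homogeneousComponent d i = i' at hij2 hi'
    generalize homogeneousComponent d j = j' at hij2 hj' hjh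
    obtain ⟨c', l, hjl, -⟩ := F.reduce g j' _ _ hd hg hxg hjh
    have hcg : C c' * w ^ (d - ordDeg I) * g ∈ I := I.mul_mem_left _ hgI
    have hxl : x * l ∈ I := by
      have : x * l = j' - C c' * w ^ (d - ordDeg I) * g := by rw [hjl]; ring
      rw [this]; exact I.sub_mem hj' hcg
    have hwl : w * l ∈ I := linear_mul_mem I l w F.hw (hIx l hxl)
    have hg0 : eval v g ≠ 0 := fun h => hxg ((F.dvd_iff g _ hg).2 h)
    have hcc : c = c' := by
      have h1 := congrArg (eval v) hij2
      rw [hfh, hjl] at h1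
      simpa [F.ew, F.ez, hg0] using h1
    subst hcc
    have : w * h = i' + w * l := by
      apply mul_left_cancel₀ hx0
      linear_combination hij2 + w * hjl - w * hfh
    rw [this]
    exact I.add_mem hi' hwl
  refine (isFull_iff _).2 ⟨x, hx0, hx, F.fullAt _ fun a ha => ?_⟩
  obtain ⟨i, hi, q, hq, hiq⟩ := Submodule.mem_sup.1 ha
  obtain ⟨b, rfl⟩ := Ideal.mem_span_singleton'.1 hq
  have h1 : x * (a - b * h) ∈ I := by
    have : x * (a - b * h) = i + b * (C c * w ^ (d - ordDeg I) * g) := by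
      linear_combination b * hfh - hiq
    rw [this]
    exact I.add_mem hi (I.mul_mem_left _ hgI')
  have h2 : w * (a - b * h) ∈ I := linear_mul_mem I _ w F.hw (hIx _ h1)
  have h3 : w * a = w * (a - b * h) + b * (w * h) := by ring
  rw [h3]
  exact (le_sup_left : I ≤ I + Ideal.span {f}) (I.add_mem h2 (I.mul_mem_left _ hwh))

theorem full_add_principal_iff_colon_contains_linear {k : Type*} [Field k] [Infinite k]
    (I : Ideal (MvPolynomial (Fin 2) k))
    (hI0 : I ≠ ⊥) (hItop : I ≠ ⊤)
    (hIhom : IsHomogeneousIdeal I) (hIfull : IsFull I)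
    (f : MvPolynomial (Fin 2) k) (d : ℕ) (hf0 : f ≠ 0) (hfhom : f.IsHomogeneous d)
    (hd : ordDeg I ≤ d)
    (hmu : mu (I + Ideal.span {f}) = mu I + 1) :
    IsFull (I + Ideal.span {f}) ↔
      ∃ z : MvPolynomial (Fin 2) k, z ≠ 0 ∧ z.IsHomogeneous 1 ∧
        z ∈ Submodule.colon I (Ideal.span {f}) := by
  simp only [Ideal.mem_colon_span_singleton]
  exact ⟨main_forward I hI0 hIhom hIfull f d hfhom hd,
    main_backward I hI0 hIhom hIfull f d hfhom hd hmu⟩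

end
end
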